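/- arXiv:2509.19800 — 11 statements merged into one kernel-verified Lean document; each statement's English description precedes it below -/
import Mathlib

section
/- Let Q̃_η be a minimizer of f_η over D, let Q_0 ∈ D be a strictly feasible initial point, let c > f_η(Q_0), and let L_c := {Q ∈ D : f_η(Q) ≤ c}. Then there exist constants μ > 0 and L > 0 such that f_η is μ-strongly convex on L_c and the gradient map G is L-Lipschitz on L_c (with respect to the Euclidean norm), and for every step size α with 0 < α ≤ 2/(L + μ), the gradient descent iterates Q_{k+1} := Q_k − α G(Q_k) remain in L_c for all k and satisfy ‖Q_k − Q̃_η‖₂² ≤ (1 − 2αμL/(μ + L))^k ‖Q_0 − Q̃_η‖₂² for all k ≥ 0. -/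
open Finset

variable {S A : Type*}

/-- The operator `(FQ)(s,a,a') = R(s,a) + γ ∑_{s'} P(s'|s,a) Q(s',a')`. -/
noncomputable def Fop [Fintype S] (P : S → A → S → ℝ) (R : S → A → ℝ) (γ : ℝ)
    (Q : S × A → ℝ) (s : S) (a a' : A) : ℝ :=
  R s a + γ * ∑ s' : S, P s a s' * Q (s', a')

/-- The strictly feasible domain `D`. -/
def FeasDom [Fintype S] (P : S → A → S → ℝ) (R : S → A → ℝ) (γ : ℝ) : Set (S × A → ℝ) :=
  {Q | ∀ s a a', Fop P R γ Q s a a' < Q (s, a)}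

/-- The log-barrier objective `f_η`. -/
noncomputable def fObj [Fintype S] [Fintype A] (P : S → A → S → ℝ) (R : S → A → ℝ) (γ : ℝ)
    (ρ : S × A → ℝ) (w : S × A × A → ℝ) (η : ℝ) (Q : S × A → ℝ) : ℝ :=
  ∑ p : S × A, ρ p * Q p -
    η * ∑ t : S × A × A, w t * Real.log (Q (t.1, t.2.1) - Fop P R γ Q t.1 t.2.1 t.2.2)

/-- `λ_η(Q)(s,a,a') = η w(s,a,a') / (Q(s,a) − (FQ)(s,a,a'))`. -/
noncomputable def lamEta [Fintype S] (P : S → A → S → ℝ) (R : S → A → ℝ) (γ : ℝ)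
    (w : S × A × A → ℝ) (η : ℝ) (Q : S × A → ℝ) (s : S) (a a' : A) : ℝ :=
  η * w (s, a, a') / (Q (s, a) - Fop P R γ Q s a a')

/-- The gradient map `G(Q)(s,a) = ρ(s,a) + γ ∑_{(s',a')} P(s|s',a') λ_η(Q)(s',a',a)
    − ∑_{a'} λ_η(Q)(s,a,a')`. -/
noncomputable def Gmap [Fintype S] [Fintype A] (P : S → A → S → ℝ) (R : S → A → ℝ) (γ : ℝ)
    (ρ : S × A → ℝ) (w : S × A × A → ℝ) (η : ℝ) (Q : S × A → ℝ) : S × A → ℝ :=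
  fun p => ρ p + γ * ∑ q : S × A, P q.1 q.2 p.1 * lamEta P R γ w η Q q.1 q.2 p.2 -
    ∑ a' : A, lamEta P R γ w η Q p.1 p.2 a'

/-- The sublevel set `L_c = {Q ∈ D : f_η(Q) ≤ c}`. -/
def SubLevel [Fintype S] [Fintype A] (P : S → A → S → ℝ) (R : S → A → ℝ) (γ : ℝ)
    (ρ : S × A → ℝ) (w : S × A × A → ℝ) (η : ℝ) (c : ℝ) : Set (S × A → ℝ) :=
  {Q | Q ∈ FeasDom P R γ ∧ fObj P R γ ρ w η Q ≤ c}

lemma gd_mono (h h' : ℝ → ℝ) (x y : ℝ) (hd : ∀ c ∈ Set.uIcc x y, HasDerivAt h (h' c) c)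
    (hs : ∀ c ∈ Set.uIcc x y, 0 ≤ h' c * (y - x)) : h x ≤ h y := by
  rcases lt_trichotomy x y with hxy | hxy | hxy
  · rw [Set.uIcc_of_le hxy.le] at hd hs
    obtain ⟨c, hc, he⟩ := exists_hasDerivAt_eq_slope h h' hxy
      (fun z hz => (hd z hz).continuousAt.continuousWithinAt)
      (fun z hz => hd z (Set.Ioo_subset_Icc_self hz))
    have := hs c (Set.Ioo_subset_Icc_self hc)
    rw [he, div_mul_cancel₀ _ (by linarith)] at this
    linarith
  · rw [hxy]
  · rw [Set.uIcc_of_ge hxy.le] at hd hs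
    obtain ⟨c, hc, he⟩ := exists_hasDerivAt_eq_slope h h' hxy
      (fun z hz => (hd z hz).continuousAt.continuousWithinAt)
      (fun z hz => hd z (Set.Ioo_subset_Icc_self hz))
    have := hs c (Set.Ioo_subset_Icc_self hc)
    have e : h' c * (y - x) = -(h' c * (x - y)) := by ring
    rw [e, he, div_mul_cancel₀ _ (by linarith)] at this
    linarith

lemma gd_between {x y c : ℝ} (hc : c ∈ Set.uIcc x y) : 0 ≤ (c - x) * (y - x) := by
  rcases le_total x y with h | h
  · rw [Set.uIcc_of_le h] at hc
    exact mul_nonneg (by linarith [hc.1]) (by linarith)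
  · rw [Set.uIcc_of_ge h] at hc
    exact mul_nonneg_of_nonpos_of_nonpos (by linarith [hc.2]) (by linarith)

lemma gd_logUp {x y M : ℝ} (hx : 0 < x) (hy : 0 < y) (hxM : x ≤ M) (hyM : y ≤ M) :
    Real.log y ≤ Real.log x + (y - x) / x - (y - x) ^ 2 / (2 * M ^ 2) := by
  have hM : 0 < M := by linarith
  have := gd_mono (fun z => (z - x) / x - (z - x) ^ 2 / (2 * M ^ 2) - Real.log z)
    (fun z => 1 / x - (2 * (z - x)) / (2 * M ^ 2) - z⁻¹) x y ?_ ?_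
  · simp at this; linarith
  · intro c hc
    have hc0 : 0 < c := lt_of_lt_of_le (lt_min hx hy) hc.1
    have h1 := ((hasDerivAt_id c).sub_const x)
    have h2 := ((h1.div_const x).sub ((h1.pow 2).div_const (2 * M ^ 2))).sub
      (Real.hasDerivAt_log hc0.ne')
    exact h2.congr_deriv (by simp)
  · intro c hc
    have hc0 : 0 < c := lt_of_lt_of_le (lt_min hx hy) hc.1
    have hcM : c ≤ M := le_trans hc.2 (max_le hxM hyM)
    have e : (1 / x - (2 * (c - x)) / (2 * M ^ 2) - c⁻¹) * (y - x)
        = ((c - x) * (y - x)) * (1 / (x * c) - 1 / M ^ 2) := by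
      field_simp
      ring
    show 0 ≤ (1 / x - (2 * (c - x)) / (2 * M ^ 2) - c⁻¹) * (y - x)
    rw [e]
    refine mul_nonneg (gd_between hc) (sub_nonneg.2 ?_)
    apply one_div_le_one_div_of_le (by positivity)
    nlinarith

lemma gd_logLow {x y m : ℝ} (hm : 0 < m) (hx : m ≤ x) (hy : m ≤ y) :
    Real.log x + (y - x) / x - (y - x) ^ 2 / (2 * m ^ 2) ≤ Real.log y := by
  have hx0 : 0 < x := by linarith
  have := gd_mono (fun z => Real.log z - (z - x) / x + (z - x) ^ 2 / (2 * m ^ 2))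
    (fun z => z⁻¹ - 1 / x + (2 * (z - x)) / (2 * m ^ 2)) x y ?_ ?_
  · simp at this; linarith
  · intro c hc
    have hcm : m ≤ c := le_trans (le_min hx hy) hc.1
    have hc0 : 0 < c := by linarith
    have h1 := ((hasDerivAt_id c).sub_const x)
    have h2 := ((Real.hasDerivAt_log hc0.ne').sub (h1.div_const x)).add
      ((h1.pow 2).div_const (2 * m ^ 2))
    exact h2.congr_deriv (by simp)
  · intro c hc
    have hcm : m ≤ c := le_trans (le_min hx hy) hc.1
    have hc0 : 0 < c := by linarith
    have e : (c⁻¹ - 1 / x + (2 * (c - x)) / (2 * m ^ 2)) * (y - x)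
        = ((c - x) * (y - x)) * (1 / m ^ 2 - 1 / (x * c)) := by
      field_simp
      ring
    show 0 ≤ (c⁻¹ - 1 / x + (2 * (c - x)) / (2 * m ^ 2)) * (y - x)
    rw [e]
    refine mul_nonneg (gd_between hc) (sub_nonneg.2 ?_)
    apply one_div_le_one_div_of_le (by positivity)
    nlinarith

lemma gd_logSC {x y M t : ℝ} (hx : 0 < x) (hy : 0 < y) (hxM : x ≤ M) (hyM : y ≤ M)
    (ht0 : 0 ≤ t) (ht1 : t ≤ 1) :
    t * Real.log x + (1 - t) * Real.log y + t * (1 - t) * ((x - y) ^ 2 / (2 * M ^ 2))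
      ≤ Real.log (t * x + (1 - t) * y) := by
  set z := t * x + (1 - t) * y with hz
  have hz0 : 0 < z := by
    rcases ht0.eq_or_lt with h | h
    · rw [hz, ← h]; simpa using hy
    · have : 0 ≤ (1 - t) * y := mul_nonneg (by linarith) hy.le
      have := mul_pos h hx
      linarith
  have hzM : z ≤ M := by nlinarith
  have h1 := mul_le_mul_of_nonneg_left (gd_logUp hz0 hx hzM hxM) ht0
  have h2 := mul_le_mul_of_nonneg_left (gd_logUp hz0 hy hzM hyM) (sub_nonneg.2 ht1)
  have e : t * (Real.log z + (x - z) / z - (x - z) ^ 2 / (2 * M ^ 2)) +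
    (1 - t) * (Real.log z + (y - z) / z - (y - z) ^ 2 / (2 * M ^ 2)) =
    Real.log z - t * (1 - t) * ((x - y) ^ 2 / (2 * M ^ 2)) := by
    have e1 : t * ((x - z) / z) + (1 - t) * ((y - z) / z) = 0 := by
      rw [← mul_div_assoc, ← mul_div_assoc, ← add_div, div_eq_zero_iff]
      left; rw [hz]; ring
    have e2 : t * ((x - z) ^ 2 / (2 * M ^ 2)) + (1 - t) * ((y - z) ^ 2 / (2 * M ^ 2))
      = t * (1 - t) * ((x - y) ^ 2 / (2 * M ^ 2)) := by
      rw [hz]; ring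
    linear_combination e1 - e2
  linarith

section gdabs

variable {ι T : Type*} [Fintype ι] [Fintype T]

noncomputable def gdsl (a : T → ι → ℝ) (b : T → ℝ) (t : T) (Q : ι → ℝ) : ℝ :=
  ∑ p, a t p * Q p - b t

noncomputable def gdF (ρ : ι → ℝ) (v : T → ℝ) (a : T → ι → ℝ) (b : T → ℝ) (Q : ι → ℝ) : ℝ :=
  ∑ p, ρ p * Q p - ∑ t, v t * Real.log (gdsl a b t Q)

noncomputable def gdG (ρ : ι → ℝ) (v : T → ℝ) (a : T → ι → ℝ) (b : T → ℝ) (Q : ι → ℝ) (p : ι) :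
    ℝ :=
  ρ p - ∑ t, v t / gdsl a b t Q * a t p

lemma gdsl_sub (a : T → ι → ℝ) (b : T → ℝ) (t : T) (Q Q' : ι → ℝ) :
    gdsl a b t Q' - gdsl a b t Q = ∑ p, a t p * (Q' p - Q p) := by
  simp only [gdsl, mul_sub, Finset.sum_sub_distrib]; ring

lemma gdG_inner (ρ : ι → ℝ) (v : T → ℝ) (a : T → ι → ℝ) (b : T → ℝ) (Q d : ι → ℝ) :
    ∑ p, gdG ρ v a b Q p * d p =
      ∑ p, ρ p * d p - ∑ t, v t * ((∑ p, a t p * d p) / gdsl a b t Q) := by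
  simp only [gdG, sub_mul, Finset.sum_sub_distrib, Finset.sum_mul]
  rw [Finset.sum_comm]
  congr 1
  refine Finset.sum_congr rfl fun t _ => ?_
  rw [Finset.sum_div, Finset.mul_sum]
  refine Finset.sum_congr rfl fun p _ => ?_
  ring

/-- The constant bounding the Hessian. -/
noncomputable def gdK (v : T → ℝ) (a : T → ι → ℝ) (m : ℝ) : ℝ :=
  ∑ t, v t / m ^ 2 * ∑ p, a t p ^ 2

/-- Quadratic upper bound. -/
lemma gd_quad (ρ : ι → ℝ) (v : T → ℝ) (hv : ∀ t, 0 < v t) (a : T → ι → ℝ) (b : T → ℝ)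
    {m : ℝ} (hm : 0 < m) (Q Q' : ι → ℝ) (hQ : ∀ t, m ≤ gdsl a b t Q)
    (hQ' : ∀ t, m ≤ gdsl a b t Q') :
    gdF ρ v a b Q' ≤ gdF ρ v a b Q + ∑ p, gdG ρ v a b Q p * (Q' p - Q p) +
      gdK v a m / 2 * ∑ p, (Q' p - Q p) ^ 2 := by
  have h1 : ∀ t, v t * Real.log (gdsl a b t Q) +
      v t * ((∑ p, a t p * (Q' p - Q p)) / gdsl a b t Q) -
      (v t / m ^ 2 * ∑ p, a t p ^ 2) / 2 * ∑ p, (Q' p - Q p) ^ 2 ≤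
      v t * Real.log (gdsl a b t Q') := by
    intro t
    have h := gd_logLow hm (hQ t) (hQ' t)
    rw [gdsl_sub] at h
    have cs := Finset.sum_mul_sq_le_sq_mul_sq Finset.univ (a t) (fun p => Q' p - Q p)
    have h2 : (∑ p, a t p * (Q' p - Q p)) ^ 2 / (2 * m ^ 2) ≤
      ((∑ p, a t p ^ 2) * ∑ p, (Q' p - Q p) ^ 2) / (2 * m ^ 2) := by gcongr
    have h3 : Real.log (gdsl a b t Q) + (∑ p, a t p * (Q' p - Q p)) / gdsl a b t Q -
      ((∑ p, a t p ^ 2) * ∑ p, (Q' p - Q p) ^ 2) / (2 * m ^ 2) ≤ Real.log (gdsl a b t Q') := by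
      linarith
    have h4 := mul_le_mul_of_nonneg_left h3 (hv t).le
    refine le_trans (le_of_eq ?_) h4
    ring
  have h2 := Finset.sum_le_sum fun t (_ : t ∈ Finset.univ) => h1 t
  rw [gdG_inner]
  simp only [Finset.sum_sub_distrib, Finset.sum_add_distrib, ← Finset.sum_mul,
    ← Finset.sum_div] at h2
  have e : ∑ p, ρ p * (Q' p - Q p) = ∑ p, ρ p * Q' p - ∑ p, ρ p * Q p := by
    simp only [mul_sub, Finset.sum_sub_distrib]
  rw [e]
  simp only [gdF, gdK]
  linarith

/-- Bound for the change of slack per unit step. -/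
noncomputable def gdB (ρ : ι → ℝ) (v : T → ℝ) (a : T → ι → ℝ) (m : ℝ) : ℝ :=
  ∑ t, ∑ p, |a t p| * (|ρ p| + ∑ t', v t' / m * |a t' p|)

lemma gdB_nonneg (ρ : ι → ℝ) (v : T → ℝ) (hv : ∀ t, 0 < v t) (a : T → ι → ℝ)
    {m : ℝ} (hm : 0 < m) : 0 ≤ gdB ρ v a m := by
  unfold gdB
  refine Finset.sum_nonneg fun t _ => Finset.sum_nonneg fun p _ => mul_nonneg (abs_nonneg _) ?_
  refine add_nonneg (abs_nonneg _) (Finset.sum_nonneg fun t' _ => ?_)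
  have := hv t'
  positivity

lemma gdK_nonneg (v : T → ℝ) (hv : ∀ t, 0 < v t) (a : T → ι → ℝ) (m : ℝ) : 0 ≤ gdK v a m := by
  unfold gdK
  refine Finset.sum_nonneg fun t _ => ?_
  have := hv t
  positivity

lemma gd_aG (ρ : ι → ℝ) (v : T → ℝ) (hv : ∀ t, 0 < v t) (a : T → ι → ℝ) (b : T → ℝ)
    {m : ℝ} (hm : 0 < m) (Q : ι → ℝ) (hQ : ∀ t, m ≤ gdsl a b t Q) (t : T) :
    ∑ p, a t p * gdG ρ v a b Q p ≤ gdB ρ v a m := by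
  have h1 : ∑ p, a t p * gdG ρ v a b Q p ≤
      ∑ p, |a t p| * (|ρ p| + ∑ t', v t' / m * |a t' p|) := by
    refine Finset.sum_le_sum fun p _ => ?_
    refine (le_abs_self _).trans ?_
    rw [abs_mul]
    refine mul_le_mul_of_nonneg_left ?_ (abs_nonneg _)
    refine (abs_sub _ _).trans ?_
    gcongr
    refine (Finset.abs_sum_le_sum_abs _ _).trans (Finset.sum_le_sum fun t' _ => ?_)
    have h0 := hv t'
    have h1 := hQ t'
    rw [abs_mul, abs_of_pos (div_pos h0 (by linarith))]
    gcongr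
  refine h1.trans ?_
  unfold gdB
  refine Finset.single_le_sum (f := fun t => ∑ p, |a t p| * (|ρ p| + ∑ t', v t' / m * |a t' p|))
    (fun t _ => Finset.sum_nonneg fun p _ => mul_nonneg (abs_nonneg _) ?_) (Finset.mem_univ t)
  refine add_nonneg (abs_nonneg _) (Finset.sum_nonneg fun t' _ => ?_)
  have := hv t'
  positivity

/-- One gradient step. -/
lemma gd_step (ρ : ι → ℝ) (v : T → ℝ) (hv : ∀ t, 0 < v t) (a : T → ι → ℝ) (b : T → ℝ)
    {m : ℝ} (hm : 0 < m) (Q Q' : ι → ℝ) (hQ : ∀ t, m ≤ gdsl a b t Q) {α : ℝ} (hα : 0 < α)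
    (h1 : α * gdB ρ v a m ≤ m / 2) (h2 : gdK v a (m / 2) * α ≤ 1)
    (hQ' : ∀ p, Q' p = Q p - α * gdG ρ v a b Q p) :
    (∀ t, 0 < gdsl a b t Q') ∧
      gdF ρ v a b Q' ≤ gdF ρ v a b Q - α / 2 * ∑ p, gdG ρ v a b Q p ^ 2 := by
  have hs : ∀ t, m / 2 ≤ gdsl a b t Q' := by
    intro t
    have e := gdsl_sub a b t Q Q'
    have e2 : ∑ p, a t p * (Q' p - Q p) = - (α * ∑ p, a t p * gdG ρ v a b Q p) := by
      rw [Finset.mul_sum, ← Finset.sum_neg_distrib]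
      refine Finset.sum_congr rfl fun p _ => ?_
      rw [hQ']; ring
    have h3 := mul_le_mul_of_nonneg_left (gd_aG ρ v hv a b hm Q hQ t) hα.le
    have := hQ t
    linarith
  refine ⟨fun t => lt_of_lt_of_le (by positivity) (hs t), ?_⟩
  have hq := gd_quad ρ v hv a b (half_pos hm) Q Q' (fun t => by linarith [hQ t]) hs
  have e1 : ∑ p, gdG ρ v a b Q p * (Q' p - Q p) = - α * ∑ p, gdG ρ v a b Q p ^ 2 := by
    rw [Finset.mul_sum]
    refine Finset.sum_congr rfl fun p _ => ?_
    rw [hQ']; ring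
  have e2 : ∑ p, (Q' p - Q p) ^ 2 = α ^ 2 * ∑ p, gdG ρ v a b Q p ^ 2 := by
    rw [Finset.mul_sum]
    refine Finset.sum_congr rfl fun p _ => ?_
    rw [hQ']; ring
  rw [e1, e2] at hq
  have hN : 0 ≤ ∑ p, gdG ρ v a b Q p ^ 2 := Finset.sum_nonneg fun p _ => sq_nonneg _
  have := mul_le_mul_of_nonneg_right h2 (mul_nonneg hα.le hN)
  nlinarith

lemma gd_exists_lower (g : T → ℝ) (hg : ∀ t, 0 < g t) : ∃ m > 0, ∀ t, m ≤ g t := by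
  rcases isEmpty_or_nonempty T with h | h
  · exact ⟨1, one_pos, fun t => (h.false t).elim⟩
  · obtain ⟨t0, h0⟩ := Finite.exists_min g
    exact ⟨g t0, hg t0, h0⟩

/-- The gradient vanishes at a minimizer. -/
lemma gd_stationary (ρ : ι → ℝ) (v : T → ℝ) (hv : ∀ t, 0 < v t) (a : T → ι → ℝ) (b : T → ℝ)
    (Qt : ι → ℝ) (hQt : ∀ t, 0 < gdsl a b t Qt)
    (hmin : ∀ Q, (∀ t, 0 < gdsl a b t Q) → gdF ρ v a b Qt ≤ gdF ρ v a b Q) (p : ι) :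
    gdG ρ v a b Qt p = 0 := by
  obtain ⟨m, hm, hmt⟩ := gd_exists_lower _ hQt
  have hB := gdB_nonneg ρ v hv a hm
  have hK := gdK_nonneg v hv a (m / 2)
  set α := min (m / 2 / (gdB ρ v a m + 1)) (1 / (gdK v a (m / 2) + 1)) with hα
  have hα0 : 0 < α := lt_min (by positivity) (by positivity)
  have h1 : α * (gdB ρ v a m + 1) ≤ m / 2 := by
    rw [← le_div_iff₀ (by positivity)]; exact min_le_left _ _
  have h2 : α * (gdK v a (m / 2) + 1) ≤ 1 := by
    rw [← le_div_iff₀ (by positivity)]; exact min_le_right _ _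
  obtain ⟨h3, h4⟩ := gd_step ρ v hv a b hm Qt (fun p => Qt p - α * gdG ρ v a b Qt p) hmt hα0
    (by nlinarith) (by nlinarith) (fun p => rfl)
  have h5 := hmin _ h3
  have hN : 0 ≤ ∑ p, gdG ρ v a b Qt p ^ 2 := Finset.sum_nonneg fun p _ => sq_nonneg _
  have h6 : ∑ p, gdG ρ v a b Qt p ^ 2 = 0 := by
    by_contra hne
    have : 0 < ∑ p, gdG ρ v a b Qt p ^ 2 := lt_of_le_of_ne hN (Ne.symm hne)
    have := mul_pos (half_pos hα0) this
    linarith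
  have := (Finset.sum_eq_zero_iff_of_nonneg (fun p _ => sq_nonneg _)).1 h6 p (Finset.mem_univ p)
  exact pow_eq_zero_iff (two_ne_zero) |>.1 this

/-- Slack bounds on sublevel sets. -/
lemma gd_bounds (ρ : ι → ℝ) (v : T → ℝ) (hv : ∀ t, 0 < v t) (a : T → ι → ℝ) (b : T → ℝ)
    (Qt : ι → ℝ) (hQt : ∀ t, 0 < gdsl a b t Qt) (hG : ∀ p, gdG ρ v a b Qt p = 0) (c : ℝ) :
    ∃ m > 0, ∃ M > 0, ∀ Q, (∀ t, 0 < gdsl a b t Q) → gdF ρ v a b Q ≤ c →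
      ∀ t, m ≤ gdsl a b t Q ∧ gdsl a b t Q ≤ M := by
  -- per-constraint bound
  have key : ∀ Q, (∀ t, 0 < gdsl a b t Q) → gdF ρ v a b Q ≤ c → ∀ t,
      gdsl a b t Q / gdsl a b t Qt - 1 - Real.log (gdsl a b t Q / gdsl a b t Qt) ≤
        (c - gdF ρ v a b Qt) / v t := by
    intro Q hQ hc t
    have e : ∑ t, v t * (gdsl a b t Q / gdsl a b t Qt - 1 -
        Real.log (gdsl a b t Q / gdsl a b t Qt)) = gdF ρ v a b Q - gdF ρ v a b Qt := by
      have h0 := gdG_inner ρ v a b Qt (fun p => Q p - Qt p)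
      simp only [hG, zero_mul, Finset.sum_const_zero, ← gdsl_sub a b] at h0
      have h1 : ∑ p, ρ p * (Q p - Qt p) = ∑ p, ρ p * Q p - ∑ p, ρ p * Qt p := by
        simp only [mul_sub, Finset.sum_sub_distrib]
      have h2 : ∀ t, v t * (gdsl a b t Q / gdsl a b t Qt - 1 -
        Real.log (gdsl a b t Q / gdsl a b t Qt)) =
        v t * ((gdsl a b t Q - gdsl a b t Qt) / gdsl a b t Qt) -
          (v t * Real.log (gdsl a b t Q) - v t * Real.log (gdsl a b t Qt)) := by
        intro t
        rw [Real.log_div (hQ t).ne' (hQt t).ne', sub_div, div_self (hQt t).ne']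
        ring
      simp only [h2, Finset.sum_sub_distrib, gdF]
      linarith
    have h3 := Finset.single_le_sum (f := fun t => v t * (gdsl a b t Q / gdsl a b t Qt - 1 -
        Real.log (gdsl a b t Q / gdsl a b t Qt))) (fun t _ => mul_nonneg (hv t).le (by
          have := Real.log_le_sub_one_of_pos (div_pos (hQ t) (hQt t)); linarith))
        (Finset.mem_univ t)
    rw [le_div_iff₀ (hv t)]
    simp only [e] at h3
    linarith
  set C := fun t => (c - gdF ρ v a b Qt) / v t with hC
  obtain ⟨m, hm, hmt⟩ := gd_exists_lower (fun t => gdsl a b t Qt * Real.exp (-(C t + 1)))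
    (fun t => mul_pos (hQt t) (Real.exp_pos _))
  obtain ⟨M, hM, hMt⟩ := gd_exists_lower
    (fun t => (gdsl a b t Qt * (2 * (|C t| + 1)))⁻¹)
    (fun t => by have := hQt t; positivity)
  refine ⟨m, hm, M⁻¹, inv_pos.2 hM, fun Q hQ hc t => ?_⟩
  have hk := key Q hQ hc t
  have hu : 0 < gdsl a b t Q / gdsl a b t Qt := div_pos (hQ t) (hQt t)
  set u := gdsl a b t Q / gdsl a b t Qt with hudef
  have hgu : gdsl a b t Q = gdsl a b t Qt * u := by
    rw [hudef, mul_div_cancel₀ _ (hQt t).ne']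
  constructor
  · refine (hmt t).trans ?_
    rw [hgu]
    refine mul_le_mul_of_nonneg_left ?_ (hQt t).le
    rw [← Real.le_log_iff_exp_le hu]
    have : u - 1 - Real.log u ≤ C t := hk
    linarith
  · have h1 : gdsl a b t Qt * (2 * (|C t| + 1)) ≤ M⁻¹ := by
      rw [← inv_inv (gdsl a b t Qt * _)]
      exact inv_anti₀ hM (hMt t)
    refine le_trans ?_ h1
    rw [hgu]
    refine mul_le_mul_of_nonneg_left ?_ (hQt t).le
    have h2 := Real.log_le_sub_one_of_pos (half_pos hu)
    rw [Real.log_div hu.ne' two_ne_zero] at h2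
    have h3 := Real.log_le_sub_one_of_pos (zero_lt_two (α := ℝ))
    have : u - 1 - Real.log u ≤ C t := hk
    have := le_abs_self (C t)
    linarith

/-- Spectral-type bounds for the secant of `G`. -/
lemma gd_secant (ρ : ι → ℝ) (v : T → ℝ) (hv : ∀ t, 0 < v t) (a : T → ι → ℝ) (b : T → ℝ)
    {m M κ : ℝ} (hm : 0 < m) (hM : 0 < M)
    (hκ : ∀ d : ι → ℝ, κ * ∑ p, d p ^ 2 ≤ ∑ t, v t * (∑ p, a t p * d p) ^ 2)
    (Q1 Q2 : ι → ℝ) (h1 : ∀ t, m ≤ gdsl a b t Q1 ∧ gdsl a b t Q1 ≤ M)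
    (h2 : ∀ t, m ≤ gdsl a b t Q2 ∧ gdsl a b t Q2 ≤ M) :
    κ / M ^ 2 * ∑ p, (Q1 p - Q2 p) ^ 2 ≤
        ∑ p, (gdG ρ v a b Q1 p - gdG ρ v a b Q2 p) * (Q1 p - Q2 p) ∧
    ∑ p, (gdG ρ v a b Q1 p - gdG ρ v a b Q2 p) * (Q1 p - Q2 p) ≤
      gdK v a m * ∑ p, (Q1 p - Q2 p) ^ 2 ∧
    ∑ p, (gdG ρ v a b Q1 p - gdG ρ v a b Q2 p) ^ 2 ≤
      gdK v a m * ∑ p, (gdG ρ v a b Q1 p - gdG ρ v a b Q2 p) * (Q1 p - Q2 p) := by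
  have p1 : ∀ t, 0 < gdsl a b t Q1 := fun t => hm.trans_le (h1 t).1
  have p2 : ∀ t, 0 < gdsl a b t Q2 := fun t => hm.trans_le (h2 t).1
  set h : T → ℝ := fun t => v t / (gdsl a b t Q1 * gdsl a b t Q2) with hh
  set y : T → ℝ := fun t => ∑ p, a t p * (Q1 p - Q2 p) with hy
  have hpos : ∀ t, 0 < h t := fun t => div_pos (hv t) (mul_pos (p1 t) (p2 t))
  have hup : ∀ t, h t ≤ v t / m ^ 2 := by
    intro t
    have := hv t
    have := mul_le_mul (h1 t).1 (h2 t).1 hm.le (p1 t).le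
    simp only [hh]
    rw [sq]
    gcongr
  have hlo : ∀ t, v t / M ^ 2 ≤ h t := by
    intro t
    have := hv t
    have := mul_le_mul (h1 t).2 (h2 t).2 (p2 t).le hM.le
    have := mul_pos (p1 t) (p2 t)
    simp only [hh]
    rw [sq]
    gcongr
  have eG : ∀ p, gdG ρ v a b Q1 p - gdG ρ v a b Q2 p = ∑ t, h t * a t p * y t := by
    intro p
    simp only [gdG]
    rw [sub_sub_sub_cancel_left, ← Finset.sum_sub_distrib]
    refine Finset.sum_congr rfl fun t _ => ?_
    simp only [hy, hh, ← gdsl_sub a b]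
    have := (p1 t).ne'
    have := (p2 t).ne'
    field_simp
  have eI : ∑ p, (gdG ρ v a b Q1 p - gdG ρ v a b Q2 p) * (Q1 p - Q2 p) = ∑ t, h t * y t ^ 2 := by
    simp only [eG, Finset.sum_mul]
    rw [Finset.sum_comm]
    refine Finset.sum_congr rfl fun t _ => ?_
    have : y t ^ 2 = y t * ∑ p, a t p * (Q1 p - Q2 p) := by rw [sq]
    rw [this, Finset.mul_sum, Finset.mul_sum]
    refine Finset.sum_congr rfl fun p _ => ?_
    ring
  have eK : ∑ t, h t * ∑ p, a t p ^ 2 ≤ gdK v a m := by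
    unfold gdK
    refine Finset.sum_le_sum fun t _ => mul_le_mul_of_nonneg_right (hup t) ?_
    exact Finset.sum_nonneg fun p _ => sq_nonneg _
  have hI0 : 0 ≤ ∑ t, h t * y t ^ 2 :=
    Finset.sum_nonneg fun t _ => mul_nonneg (hpos t).le (sq_nonneg _)
  refine ⟨?_, ?_, ?_⟩
  · rw [eI]
    have h3 := hκ (fun p => Q1 p - Q2 p)
    have h4 : (∑ t, v t * y t ^ 2) / M ^ 2 ≤ ∑ t, h t * y t ^ 2 := by
      rw [Finset.sum_div]
      refine Finset.sum_le_sum fun t _ => ?_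
      have := mul_le_mul_of_nonneg_right (hlo t) (sq_nonneg (y t))
      refine le_trans (le_of_eq ?_) this
      ring
    refine le_trans ?_ h4
    rw [div_mul_eq_mul_div]
    gcongr
  · rw [eI]
    refine le_trans ?_ (mul_le_mul_of_nonneg_right eK (Finset.sum_nonneg fun p _ => sq_nonneg _))
    rw [Finset.sum_mul]
    refine Finset.sum_le_sum fun t _ => ?_
    rw [mul_assoc]
    exact mul_le_mul_of_nonneg_left
      (Finset.sum_mul_sq_le_sq_mul_sq Finset.univ (a t) (fun p => Q1 p - Q2 p)) (hpos t).le
  · rw [eI]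
    have h3 : ∀ p, (gdG ρ v a b Q1 p - gdG ρ v a b Q2 p) ^ 2 ≤
        (∑ t, h t * a t p ^ 2) * ∑ t, h t * y t ^ 2 := by
      intro p
      rw [eG]
      have cs := Finset.sum_mul_sq_le_sq_mul_sq Finset.univ
        (fun t => Real.sqrt (h t) * a t p) (fun t => Real.sqrt (h t) * y t)
      refine le_trans (le_of_eq ?_) (cs.trans (le_of_eq ?_))
      · congr 1
        refine Finset.sum_congr rfl fun t _ => ?_
        have := Real.mul_self_sqrt (hpos t).le
        linear_combination (-(a t p * y t)) * this
      · simp only [mul_pow, Real.sq_sqrt (hpos _).le]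
    refine (Finset.sum_le_sum fun p _ => h3 p).trans ?_
    rw [← Finset.sum_mul]
    refine mul_le_mul_of_nonneg_right ?_ hI0
    refine le_trans (le_of_eq ?_) eK
    rw [Finset.sum_comm]
    simp only [Finset.mul_sum]

lemma gd_strong (ρ : ι → ℝ) (v : T → ℝ) (hv : ∀ t, 0 < v t) (a : T → ι → ℝ) (b : T → ℝ)
    {M κ : ℝ} (hM : 0 < M)
    (hκ : ∀ d : ι → ℝ, κ * ∑ p, d p ^ 2 ≤ ∑ t, v t * (∑ p, a t p * d p) ^ 2)
    (Q1 Q2 : ι → ℝ) (h1 : ∀ t, 0 < gdsl a b t Q1 ∧ gdsl a b t Q1 ≤ M)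
    (h2 : ∀ t, 0 < gdsl a b t Q2 ∧ gdsl a b t Q2 ≤ M) (s : ℝ) (hs0 : 0 ≤ s) (hs1 : s ≤ 1) :
    gdF ρ v a b (s • Q1 + (1 - s) • Q2) ≤ s * gdF ρ v a b Q1 + (1 - s) * gdF ρ v a b Q2 -
      (κ / M ^ 2) / 2 * (s * (1 - s)) * ∑ p, (Q1 p - Q2 p) ^ 2 := by
  have e1 : ∀ t, gdsl a b t (s • Q1 + (1 - s) • Q2) =
      s * gdsl a b t Q1 + (1 - s) * gdsl a b t Q2 := by
    intro t
    simp only [gdsl, Pi.add_apply, Pi.smul_apply, smul_eq_mul, mul_sub, Finset.mul_sum]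
    have : ∀ p, a t p * (s * Q1 p + (1 - s) * Q2 p) =
      s * (a t p * Q1 p) + (1 - s) * (a t p * Q2 p) := fun p => by ring
    simp only [this, Finset.sum_add_distrib]
    ring
  have e2 : ∑ p, ρ p * (s • Q1 + (1 - s) • Q2) p =
      s * ∑ p, ρ p * Q1 p + (1 - s) * ∑ p, ρ p * Q2 p := by
    simp only [Pi.add_apply, Pi.smul_apply, smul_eq_mul, Finset.mul_sum]
    rw [← Finset.sum_add_distrib]
    exact Finset.sum_congr rfl fun p _ => by ring
  have h3 : ∑ t, (s * (v t * Real.log (gdsl a b t Q1)) +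
      (1 - s) * (v t * Real.log (gdsl a b t Q2)) +
      s * (1 - s) / (2 * M ^ 2) * (v t * (∑ p, a t p * (Q1 p - Q2 p)) ^ 2)) ≤
      ∑ t, v t * Real.log (s * gdsl a b t Q1 + (1 - s) * gdsl a b t Q2) := by
    refine Finset.sum_le_sum fun t _ => ?_
    have := mul_le_mul_of_nonneg_left
      (gd_logSC (h1 t).1 (h2 t).1 (h1 t).2 (h2 t).2 hs0 hs1) (hv t).le
    rw [gdsl_sub] at this
    refine le_trans (le_of_eq ?_) this
    ring
  simp only [Finset.sum_add_distrib, ← Finset.mul_sum] at h3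
  have h4 := mul_le_mul_of_nonneg_left (hκ (fun p => Q1 p - Q2 p))
    (div_nonneg (mul_nonneg hs0 (sub_nonneg.2 hs1)) (by positivity : 0 ≤ 2 * M ^ 2))
  have e3 : s * (1 - s) / (2 * M ^ 2) * (κ * ∑ p, (Q1 p - Q2 p) ^ 2) =
    (κ / M ^ 2) / 2 * (s * (1 - s)) * ∑ p, (Q1 p - Q2 p) ^ 2 := by
    field_simp
  simp only [gdF, e1, e2]
  linarith

theorem gd_main (ρ : ι → ℝ) (v : T → ℝ) (hv : ∀ t, 0 < v t) (a : T → ι → ℝ) (b : T → ℝ)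
    {κ : ℝ} (hκ0 : 0 < κ)
    (hκ : ∀ d : ι → ℝ, κ * ∑ p, d p ^ 2 ≤ ∑ t, v t * (∑ p, a t p * d p) ^ 2)
    (Qt : ι → ℝ) (hQt : ∀ t, 0 < gdsl a b t Qt)
    (hmin : ∀ Q, (∀ t, 0 < gdsl a b t Q) → gdF ρ v a b Qt ≤ gdF ρ v a b Q)
    (Q0 : ι → ℝ) (hQ0 : ∀ t, 0 < gdsl a b t Q0) (c : ℝ) (hc : gdF ρ v a b Q0 < c) :
    ∃ μ > 0, ∃ L > 0,
      (∀ Q1, ((∀ t, 0 < gdsl a b t Q1) ∧ gdF ρ v a b Q1 ≤ c) →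
        ∀ Q2, ((∀ t, 0 < gdsl a b t Q2) ∧ gdF ρ v a b Q2 ≤ c) →
        ∀ t : ℝ, 0 ≤ t → t ≤ 1 →
          gdF ρ v a b (t • Q1 + (1 - t) • Q2) ≤
            t * gdF ρ v a b Q1 + (1 - t) * gdF ρ v a b Q2 -
              μ / 2 * (t * (1 - t)) * ∑ p, (Q1 p - Q2 p) ^ 2) ∧
      (∀ Q1, ((∀ t, 0 < gdsl a b t Q1) ∧ gdF ρ v a b Q1 ≤ c) →
        ∀ Q2, ((∀ t, 0 < gdsl a b t Q2) ∧ gdF ρ v a b Q2 ≤ c) →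
        Real.sqrt (∑ p, (gdG ρ v a b Q1 p - gdG ρ v a b Q2 p) ^ 2) ≤
          L * Real.sqrt (∑ p, (Q1 p - Q2 p) ^ 2)) ∧
      (∀ α : ℝ, 0 < α → α ≤ 2 / (L + μ) →
        ∀ Qseq : ℕ → (ι → ℝ), Qseq 0 = Q0 →
          (∀ k, Qseq (k + 1) = Qseq k - α • gdG ρ v a b (Qseq k)) →
          (∀ k, (∀ t, 0 < gdsl a b t (Qseq k)) ∧ gdF ρ v a b (Qseq k) ≤ c) ∧
          (∀ k, ∑ p, (Qseq k p - Qt p) ^ 2 ≤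
            (1 - 2 * α * μ * L / (μ + L)) ^ k * ∑ p, (Q0 p - Qt p) ^ 2)) := by
  have hG := gd_stationary ρ v hv a b Qt hQt hmin
  obtain ⟨m, hm, M, hM, hb⟩ := gd_bounds ρ v hv a b Qt hQt hG c
  have hQtc : gdF ρ v a b Qt ≤ c := (hmin Q0 hQ0).trans hc.le
  have hB := gdB_nonneg ρ v hv a hm
  have hK := gdK_nonneg v hv a m
  have hK2 := gdK_nonneg v hv a (m / 2)
  have hμ : 0 < κ / M ^ 2 / 2 := by positivity
  set μ := κ / M ^ 2 / 2 with hμdef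
  set L := 1 + 2 * gdK v a m + 2 * gdK v a (m / 2) + 4 * gdB ρ v a m / m with hL
  have hBm : 0 ≤ 4 * gdB ρ v a m / m := by positivity
  have hL0 : 0 < L := by linarith
  refine ⟨μ, hμ, L, hL0, ?_, ?_, ?_⟩
  · rintro Q1 ⟨h1, h1c⟩ Q2 ⟨h2, h2c⟩ s hs0 hs1
    have := gd_strong ρ v hv a b hM hκ Q1 Q2 (fun t => ⟨h1 t, (hb Q1 h1 h1c t).2⟩)
      (fun t => ⟨h2 t, (hb Q2 h2 h2c t).2⟩) s hs0 hs1
    have hN : 0 ≤ ∑ p, (Q1 p - Q2 p) ^ 2 := Finset.sum_nonneg fun p _ => sq_nonneg _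
    have hx : 0 ≤ μ / 2 * (s * (1 - s)) * ∑ p, (Q1 p - Q2 p) ^ 2 := by
      have : 0 ≤ 1 - s := by linarith
      positivity
    have e : (κ / M ^ 2) / 2 * (s * (1 - s)) * ∑ p, (Q1 p - Q2 p) ^ 2 =
      2 * (μ / 2 * (s * (1 - s)) * ∑ p, (Q1 p - Q2 p) ^ 2) := by rw [hμdef]; ring
    linarith
  · rintro Q1 ⟨h1, h1c⟩ Q2 ⟨h2, h2c⟩
    obtain ⟨_, h4, h5⟩ := gd_secant ρ v hv a b hm hM hκ Q1 Q2 (hb Q1 h1 h1c) (hb Q2 h2 h2c)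
    have hN : 0 ≤ ∑ p, (Q1 p - Q2 p) ^ 2 := Finset.sum_nonneg fun p _ => sq_nonneg _
    apply Real.sqrt_le_iff.2
    refine ⟨by positivity, ?_⟩
    rw [mul_pow, Real.sq_sqrt hN]
    have h6 := mul_le_mul_of_nonneg_left h4 hK
    refine h5.trans (h6.trans ?_)
    rw [← mul_assoc, ← sq]
    have : gdK v a m ≤ L := by linarith
    gcongr
  · intro α hα hαL Qseq hs0 hs
    have hαL' : α * (L + μ) ≤ 2 := by rwa [le_div_iff₀ (by positivity)] at hαL
    have c1 : α * gdB ρ v a m ≤ m / 2 := by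
      have h1 : 4 * gdB ρ v a m / m ≤ L + μ := by linarith
      have h2 := (mul_le_mul_of_nonneg_left h1 hα.le).trans hαL'
      rw [← mul_div_assoc, div_le_iff₀ hm] at h2
      linarith
    have c2 : gdK v a (m / 2) * α ≤ 1 := by
      have h1 : 2 * gdK v a (m / 2) ≤ L + μ := by linarith
      have h2 := (mul_le_mul_of_nonneg_left h1 hα.le).trans hαL'
      linarith
    have hmem : ∀ k, (∀ t, 0 < gdsl a b t (Qseq k)) ∧ gdF ρ v a b (Qseq k) ≤ c := by
      intro k
      induction k with
      | zero => rw [hs0]; exact ⟨hQ0, hc.le⟩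
      | succ k ih =>
        obtain ⟨h3, h4⟩ := gd_step ρ v hv a b hm (Qseq k) (Qseq (k + 1))
          (fun t => (hb _ ih.1 ih.2 t).1) hα c1 c2 (fun p => by rw [hs]; rfl)
        refine ⟨h3, ?_⟩
        have hN : 0 ≤ ∑ p, gdG ρ v a b (Qseq k) p ^ 2 := Finset.sum_nonneg fun p _ => sq_nonneg _
        have : 0 ≤ α / 2 * ∑ p, gdG ρ v a b (Qseq k) p ^ 2 := by positivity
        linarith [ih.2]
    refine ⟨hmem, ?_⟩
    have hr : 0 ≤ 1 - 2 * α * μ * L / (μ + L) := by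
      rw [sub_nonneg, div_le_one (by positivity)]
      have h1 : 2 * α * μ * L * (μ + L) ≤ (μ + L) * (μ + L) := by
        have h2 : α * (L + μ) * (2 * (μ * L)) ≤ 2 * (2 * (μ * L)) :=
          mul_le_mul_of_nonneg_right hαL' (by positivity)
        nlinarith [sq_nonneg (μ - L)]
      exact le_of_mul_le_mul_right h1 (by positivity)
    intro k
    induction k with
    | zero => rw [hs0]; simp
    | succ k ih =>
      obtain ⟨h3, h4, h5⟩ := gd_secant ρ v hv a b hm hM hκ (Qseq k) Qt
        (hb _ (hmem k).1 (hmem k).2) (hb _ hQt hQtc)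
      simp only [hG, sub_zero] at h3 h4 h5
      set N := ∑ p, (Qseq k p - Qt p) ^ 2 with hN
      set I := ∑ p, gdG ρ v a b (Qseq k) p * (Qseq k p - Qt p) with hI
      set H := ∑ p, gdG ρ v a b (Qseq k) p ^ 2 with hH
      have hN0 : 0 ≤ N := Finset.sum_nonneg fun p _ => sq_nonneg _
      have hH0 : 0 ≤ H := Finset.sum_nonneg fun p _ => sq_nonneg _
      have e : ∑ p, (Qseq (k + 1) p - Qt p) ^ 2 = N - 2 * α * I + α ^ 2 * H := by
        rw [hN, hI, hH, Finset.mul_sum, Finset.mul_sum, ← Finset.sum_sub_distrib,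
          ← Finset.sum_add_distrib]
        refine Finset.sum_congr rfl fun p _ => ?_
        rw [hs]
        simp only [Pi.sub_apply, Pi.smul_apply, smul_eq_mul]
        ring
      have h3' : 2 * μ * N ≤ I := by
        refine le_trans (le_of_eq ?_) h3
        rw [hμdef]; ring
      -- coercivity
      have hI0 : 0 ≤ I := le_trans (by positivity) h3'
      have hco : μ * L * N + H ≤ (μ + L) * I := by
        have h6 : 2 * gdK v a m ≤ L := by linarith
        have h7 : H ≤ L / 2 * I := h5.trans (mul_le_mul_of_nonneg_right (by linarith) hI0)
        have h8 : L / 2 * (2 * μ * N) ≤ L / 2 * I :=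
          mul_le_mul_of_nonneg_left h3' (by positivity)
        have h9 : 0 ≤ μ * I := by positivity
        nlinarith
      have hstep : N - 2 * α * I + α ^ 2 * H ≤ (1 - 2 * α * μ * L / (μ + L)) * N := by
        have hml : 0 < μ + L := by positivity
        have e2 : (1 - 2 * α * μ * L / (μ + L)) * N =
          N - 2 * α * (μ * L * N / (μ + L)) := by ring
        have h10 : (μ * L * N + H) / (μ + L) ≤ I := by
          rw [div_le_iff₀ hml]; linarith
        have h11 : α * H ≤ 2 * (H / (μ + L)) := by
          rw [← mul_div_assoc, le_div_iff₀ hml]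
          have := mul_le_mul_of_nonneg_right hαL' hH0
          linarith
        rw [add_div] at h10
        rw [e2]
        have h12 := mul_le_mul_of_nonneg_left h10 hα.le
        have h13 := mul_le_mul_of_nonneg_left h11 hα.le
        nlinarith
      rw [e, pow_succ' (1 - 2 * α * μ * L / (μ + L))]
      refine hstep.trans ?_
      rw [mul_assoc (1 - 2 * α * μ * L / (μ + L))]
      exact mul_le_mul_of_nonneg_left ih hr

end gdabs

/-- The constraint rows. -/
noncomputable def gdRow (P : S → A → S → ℝ) (γ : ℝ) (t : S × A × A) (p : S × A) : ℝ :=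
  open Classical in
  (if p = (t.1, t.2.1) then 1 else 0) - γ * (P t.1 t.2.1 p.1 * if p.2 = t.2.2 then 1 else 0)

lemma gdRow_sum [Fintype S] [Fintype A] (P : S → A → S → ℝ) (γ : ℝ) (t : S × A × A)
    (Q : S × A → ℝ) :
    ∑ p, gdRow P γ t p * Q p =
      Q (t.1, t.2.1) - γ * ∑ s', P t.1 t.2.1 s' * Q (s', t.2.2) := by
  classical
  simp only [gdRow, sub_mul, Finset.sum_sub_distrib, ite_mul, one_mul, zero_mul,
    Finset.sum_ite_eq', Finset.mem_univ, if_true]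
  congr 1
  rw [Fintype.sum_prod_type, Finset.mul_sum]
  refine Finset.sum_congr rfl fun s _ => ?_
  rw [Finset.sum_eq_single t.2.2]
  · simp; ring
  · intro x _ hx; simp [hx]
  · simp

lemma gdRow_slack [Fintype S] [Fintype A] (P : S → A → S → ℝ) (R : S → A → ℝ) (γ : ℝ)
    (t : S × A × A) (Q : S × A → ℝ) :
    gdsl (gdRow P γ) (fun t => R t.1 t.2.1) t Q =
      Q (t.1, t.2.1) - Fop P R γ Q t.1 t.2.1 t.2.2 := by
  rw [gdsl, gdRow_sum, Fop]; ring

lemma gdRow_F [Fintype S] [Fintype A] (P : S → A → S → ℝ) (R : S → A → ℝ) (γ : ℝ)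
    (ρ : S × A → ℝ) (w : S × A × A → ℝ) (η : ℝ) (Q : S × A → ℝ) :
    fObj P R γ ρ w η Q =
      gdF ρ (fun t => η * w t) (gdRow P γ) (fun t => R t.1 t.2.1) Q := by
  simp only [fObj, gdF, gdRow_slack, Finset.mul_sum, mul_assoc]

lemma gdRow_G [Fintype S] [Fintype A] (P : S → A → S → ℝ) (R : S → A → ℝ) (γ : ℝ)
    (ρ : S × A → ℝ) (w : S × A × A → ℝ) (η : ℝ) (Q : S × A → ℝ) :
    Gmap P R γ ρ w η Q =
      gdG ρ (fun t => η * w t) (gdRow P γ) (fun t => R t.1 t.2.1) Q := by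
  classical
  funext p
  simp only [Gmap, gdG, gdRow_slack, gdRow]
  have e : ∀ t : S × A × A, η * w t / (Q (t.1, t.2.1) - Fop P R γ Q t.1 t.2.1 t.2.2) =
    lamEta P R γ w η Q t.1 t.2.1 t.2.2 := fun t => rfl
  simp only [e, mul_sub, Finset.sum_sub_distrib]
  have e1 : ∑ t : S × A × A, lamEta P R γ w η Q t.1 t.2.1 t.2.2 *
      (if p = (t.1, t.2.1) then 1 else 0) = ∑ a', lamEta P R γ w η Q p.1 p.2 a' := by
    rw [Fintype.sum_prod_type, Finset.sum_eq_single p.1]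
    · rw [Fintype.sum_prod_type, Finset.sum_eq_single p.2]
      · simp
      · intro x _ hx
        refine Finset.sum_eq_zero fun y _ => ?_
        rw [if_neg, mul_zero]
        intro h; exact hx (by rw [h])
      · simp
    · intro x _ hx
      refine Finset.sum_eq_zero fun y _ => ?_
      rw [if_neg, mul_zero]
      intro h; exact hx (by rw [h])
    · simp
  have e2 : ∑ t : S × A × A, lamEta P R γ w η Q t.1 t.2.1 t.2.2 *
      (γ * (P t.1 t.2.1 p.1 * if p.2 = t.2.2 then 1 else 0)) =
      γ * ∑ q : S × A, P q.1 q.2 p.1 * lamEta P R γ w η Q q.1 q.2 p.2 := by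
    rw [Fintype.sum_prod_type, Fintype.sum_prod_type, Finset.mul_sum]
    refine Finset.sum_congr rfl fun s _ => ?_
    rw [Fintype.sum_prod_type, Finset.mul_sum]
    refine Finset.sum_congr rfl fun x _ => ?_
    rw [Finset.sum_eq_single p.2]
    · simp; ring
    · intro y _ hy; simp [Ne.symm hy]
    · simp
  rw [e1]
  linarith

lemma gdRow_coercive [Fintype S] [Fintype A] [Nonempty S] [Nonempty A]
    (P : S → A → S → ℝ) (γ : ℝ)
    (hP0 : ∀ s a s', 0 ≤ P s a s') (hP1 : ∀ s a, ∑ s' : S, P s a s' = 1)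
    (hγ0 : 0 ≤ γ) (hγ1 : γ < 1) (v : S × A × A → ℝ) (hv : ∀ t, 0 < v t) :
    ∃ κ > 0, ∀ d : S × A → ℝ,
      κ * ∑ p, d p ^ 2 ≤ ∑ t, v t * (∑ p, gdRow P γ t p * d p) ^ 2 := by
  obtain ⟨m, hm, hmt⟩ := gd_exists_lower v hv
  set n : ℝ := (Fintype.card (S × A) : ℝ) with hn
  have hn0 : 0 < n := by rw [hn]; exact_mod_cast Fintype.card_pos
  have hg : 0 < 1 - γ := by linarith
  refine ⟨m * (1 - γ) ^ 2 / n, by positivity, fun d => ?_⟩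
  obtain ⟨p0, hp0⟩ := Finite.exists_max fun p => |d p|
  have h1 : ∑ p, d p ^ 2 ≤ n * |d p0| ^ 2 := by
    have : ∑ p, d p ^ 2 ≤ ∑ _p : S × A, |d p0| ^ 2 := by
      refine Finset.sum_le_sum fun p _ => ?_
      rw [← sq_abs (d p)]
      have := hp0 p
      gcongr
    refine this.trans (le_of_eq ?_)
    rw [Finset.sum_const, nsmul_eq_mul, Finset.card_univ]
  set t0 : S × A × A := (p0.1, p0.2, p0.2) with ht0
  have h2 : (1 - γ) * |d p0| ≤ |∑ p, gdRow P γ t0 p * d p| := by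
    rw [gdRow_sum]
    have h3 : |∑ s', P p0.1 p0.2 s' * d (s', p0.2)| ≤ |d p0| := by
      refine (Finset.abs_sum_le_sum_abs _ _).trans ?_
      have : ∑ s', |P p0.1 p0.2 s' * d (s', p0.2)| ≤ ∑ s', P p0.1 p0.2 s' * |d p0| := by
        refine Finset.sum_le_sum fun s' _ => ?_
        rw [abs_mul, abs_of_nonneg (hP0 _ _ _)]
        exact mul_le_mul_of_nonneg_left (hp0 _) (hP0 _ _ _)
      refine this.trans (le_of_eq ?_)
      rw [← Finset.sum_mul, hP1, one_mul]
    have h4 := abs_sub_abs_le_abs_sub (d p0) (γ * ∑ s', P p0.1 p0.2 s' * d (s', p0.2))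
    rw [abs_mul, abs_of_nonneg hγ0] at h4
    have h5 := mul_le_mul_of_nonneg_left h3 hγ0
    show _ ≤ |d p0 - γ * ∑ s', P p0.1 p0.2 s' * d (s', p0.2)|
    linarith
  have h6 : m * ((1 - γ) * |d p0|) ^ 2 ≤ v t0 * (∑ p, gdRow P γ t0 p * d p) ^ 2 := by
    rw [← sq_abs (∑ p, gdRow P γ t0 p * d p)]
    have := hmt t0
    have := hv t0
    gcongr
  have h7 := Finset.single_le_sum (f := fun t => v t * (∑ p, gdRow P γ t p * d p) ^ 2)
    (fun t _ => mul_nonneg (hv t).le (sq_nonneg _)) (Finset.mem_univ t0)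
  refine le_trans ?_ (h6.trans h7)
  have h8 := mul_le_mul_of_nonneg_left h1 (by positivity : 0 ≤ m * (1 - γ) ^ 2 / n)
  refine h8.trans (le_of_eq ?_)
  field_simp

theorem stmt4 [Fintype S] [Fintype A] [Nonempty S] [Nonempty A]
    (P : S → A → S → ℝ) (R : S → A → ℝ) (γ : ℝ)
    (hP0 : ∀ s a s', 0 ≤ P s a s') (hP1 : ∀ s a, ∑ s' : S, P s a s' = 1)
    (hγ0 : 0 ≤ γ) (hγ1 : γ < 1)
    (ρ : S × A → ℝ) (hρ0 : ∀ p, 0 < ρ p) (hρ1 : ∑ p : S × A, ρ p = 1)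
    (w : S × A × A → ℝ) (hw : ∀ t, 0 < w t) (η : ℝ) (hη : 0 < η)
    (Qt : S × A → ℝ) (hQtD : Qt ∈ FeasDom P R γ)
    (hQtmin : ∀ Q ∈ FeasDom P R γ, fObj P R γ ρ w η Qt ≤ fObj P R γ ρ w η Q)
    (Q0 : S × A → ℝ) (hQ0 : Q0 ∈ FeasDom P R γ)
    (c : ℝ) (hc : fObj P R γ ρ w η Q0 < c) :
    ∃ μ > 0, ∃ L > 0,
      -- μ-strong convexity of f_η on L_c (Euclidean norm)
      (∀ Q1 ∈ SubLevel P R γ ρ w η c, ∀ Q2 ∈ SubLevel P R γ ρ w η c,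
        ∀ t : ℝ, 0 ≤ t → t ≤ 1 →
          fObj P R γ ρ w η (t • Q1 + (1 - t) • Q2) ≤
            t * fObj P R γ ρ w η Q1 + (1 - t) * fObj P R γ ρ w η Q2 -
              μ / 2 * (t * (1 - t)) * ∑ p : S × A, (Q1 p - Q2 p) ^ 2) ∧
      -- L-Lipschitz continuity of the gradient map on L_c (Euclidean norm)
      (∀ Q1 ∈ SubLevel P R γ ρ w η c, ∀ Q2 ∈ SubLevel P R γ ρ w η c,
        Real.sqrt (∑ p : S × A, (Gmap P R γ ρ w η Q1 p - Gmap P R γ ρ w η Q2 p) ^ 2) ≤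
          L * Real.sqrt (∑ p : S × A, (Q1 p - Q2 p) ^ 2)) ∧
      -- gradient descent with step size 0 < α ≤ 2/(L+μ) stays in L_c and
      -- converges exponentially to Q̃_η
      (∀ α : ℝ, 0 < α → α ≤ 2 / (L + μ) →
        ∀ Qseq : ℕ → (S × A → ℝ), Qseq 0 = Q0 →
          (∀ k, Qseq (k + 1) = Qseq k - α • Gmap P R γ ρ w η (Qseq k)) →
          (∀ k, Qseq k ∈ SubLevel P R γ ρ w η c) ∧
          (∀ k, ∑ p : S × A, (Qseq k p - Qt p) ^ 2 ≤
            (1 - 2 * α * μ * L / (μ + L)) ^ k * ∑ p : S × A, (Q0 p - Qt p) ^ 2)) := by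
  obtain ⟨κ, hκ0, hκ⟩ := gdRow_coercive P γ hP0 hP1 hγ0 hγ1 (fun t => η * w t)
    (fun t => mul_pos hη (hw t))
  have hD : ∀ Q, Q ∈ FeasDom P R γ ↔
      ∀ t, 0 < gdsl (gdRow P γ) (fun t : S × A × A => R t.1 t.2.1) t Q := by
    intro Q
    simp only [gdRow_slack, sub_pos]
    exact ⟨fun h t => h _ _ _, fun h s a a' => h (s, a, a')⟩
  have hmain := gd_main ρ (fun t => η * w t) (fun t => mul_pos hη (hw t)) (gdRow P γ)
    (fun t => R t.1 t.2.1) hκ0 hκ Qt ((hD Qt).1 hQtD)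
    (fun Q hQ => by
      rw [← gdRow_F, ← gdRow_F]; exact hQtmin Q ((hD Q).2 hQ)) Q0 ((hD Q0).1 hQ0) c
    (by rw [← gdRow_F]; exact hc)
  simp only [← gdRow_F, ← gdRow_G, ← hD] at hmain
  exact hmain
end

section
/- If λ : S × A × A → ℝ is dual feasible, then the state marginal satisfies λ(s) ≥ ρ(s) > 0 for every s ∈ S, and for every s' ∈ S it holds that λ(s') − γ ∑_{s∈S} P^π(s'|s) λ(s) = ρ(s'), where π is the policy π(a|s) := λ(s,a)/λ(s) and P^π(s'|s) := ∑_{a∈A} P(s'|s,a) π(a|s). -/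
open Finset

variable {S A : Type*}

/-- State-action marginal `λ(s,a) = ∑_{a'} λ(s,a,a')`. -/
noncomputable def lamSA [Fintype A] (lam : S × A × A → ℝ) (s : S) (a : A) : ℝ :=
  ∑ a' : A, lam (s, a, a')

/-- State marginal `λ(s) = ∑_a λ(s,a)`. -/
noncomputable def lamS [Fintype A] (lam : S × A × A → ℝ) (s : S) : ℝ :=
  ∑ a : A, lamSA lam s a

theorem stmt6 [Fintype S] [Fintype A] [Nonempty S] [Nonempty A]
    (P : S → A → S → ℝ)
    (hP0 : ∀ s a s', 0 ≤ P s a s') (hP1 : ∀ s a, ∑ s' : S, P s a s' = 1)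
    (γ : ℝ) (hγ0 : 0 ≤ γ) (hγ1 : γ < 1)
    (ρ : S × A → ℝ) (hρ0 : ∀ p, 0 < ρ p) (hρ1 : ∑ p : S × A, ρ p = 1)
    (lam : S × A × A → ℝ) (hlam0 : ∀ t, 0 ≤ lam t)
    -- dual feasibility constraints
    (hlamc : ∀ s a, (∑ i : A, lam (s, a, i)) -
      γ * ∑ q : S × A, P q.1 q.2 s * lam (q.1, q.2, a) = ρ (s, a)) :
    (∀ s : S, (∑ a : A, ρ (s, a)) ≤ lamS lam s ∧ 0 < (∑ a : A, ρ (s, a))) ∧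
    -- λ(s') − γ ∑_s P^π(s'|s) λ(s) = ρ(s'), with π(a|s) = λ(s,a)/λ(s) and
    -- P^π(s'|s) = ∑_a P(s'|s,a) π(a|s)
    (∀ s' : S, lamS lam s' -
      γ * ∑ s : S, (∑ a : A, P s a s' * (lamSA lam s a / lamS lam s)) * lamS lam s =
        ∑ a : A, ρ (s', a)) := by
  have h1 : ∀ s : S, (∑ a : A, ρ (s, a)) ≤ lamS lam s ∧ 0 < (∑ a : A, ρ (s, a)) := by
    intro s
    refine ⟨?_, Finset.sum_pos (fun a _ => hρ0 _) Finset.univ_nonempty⟩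
    unfold lamS lamSA
    refine Finset.sum_le_sum fun a _ => ?_
    have h := hlamc s a
    have h2 : 0 ≤ γ * ∑ q : S × A, P q.1 q.2 s * lam (q.1, q.2, a) :=
      mul_nonneg hγ0 (Finset.sum_nonneg fun q _ => mul_nonneg (hP0 _ _ _) (hlam0 _))
    linarith
  refine ⟨h1, fun s' => ?_⟩
  have h3 : ∑ s : S, (∑ a : A, P s a s' * (lamSA lam s a / lamS lam s)) * lamS lam s
      = ∑ a : A, ∑ q : S × A, P q.1 q.2 s' * lam (q.1, q.2, a) := by
    rw [Finset.sum_comm, Fintype.sum_prod_type]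
    refine Finset.sum_congr rfl fun s _ => ?_
    have hne : lamS lam s ≠ 0 := ((h1 s).2.trans_le (h1 s).1).ne'
    rw [Finset.sum_mul]
    refine Finset.sum_congr rfl fun a _ => ?_
    rw [mul_assoc, div_mul_cancel₀ _ hne, lamSA, Finset.mul_sum]
  rw [h3, Finset.mul_sum]
  unfold lamS lamSA
  rw [← Finset.sum_sub_distrib]
  exact Finset.sum_congr rfl fun a _ => hlamc s' a
end

section
/- Let λ : S × A × A → ℝ be dual feasible with λ(s) > 0 for all s (which holds for every dual feasible λ), let π(a|s) := λ(s,a)/λ(s) be the induced policy, P^π(s'|s) := ∑_{a∈A} P(s'|s,a) π(a|s), and define the state-distribution sequence μ_0(s) := ρ(s) and μ_{k+1}(s') := ∑_{s∈S} μ_k(s) P^π(s'|s). Then for every s ∈ S the series ∑_{k=0}^∞ γ^k μ_k(s) converges and λ(s) = ∑_{k=0}^∞ γ^k μ_k(s); equivalently, (1 − γ)λ(s) is the discounted state-occupation distribution of π started from ρ. -/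
open Finset

variable {S A : Type*}

theorem stmt7 [Fintype S] [Fintype A] [Nonempty S] [Nonempty A]
    (P : S → A → S → ℝ)
    (hP0 : ∀ s a s', 0 ≤ P s a s') (hP1 : ∀ s a, ∑ s' : S, P s a s' = 1)
    (γ : ℝ) (hγ0 : 0 ≤ γ) (hγ1 : γ < 1)
    (ρ : S × A → ℝ) (hρ0 : ∀ p, 0 < ρ p) (hρ1 : ∑ p : S × A, ρ p = 1)
    (lam : S × A × A → ℝ) (hlam0 : ∀ t, 0 ≤ lam t)
    -- dual feasibility constraints
    (hlamc : ∀ s a, (∑ i : A, lam (s, a, i)) -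
      γ * ∑ q : S × A, P q.1 q.2 s * lam (q.1, q.2, a) = ρ (s, a))
    -- positivity of the state marginal (which holds for every dual feasible λ)
    (hlampos : ∀ s, 0 < lamS lam s)
    -- the induced policy π(a|s) = λ(s,a)/λ(s)
    (π : S → A → ℝ) (hπ : ∀ s a, π s a = lamSA lam s a / lamS lam s)
    -- the state-distribution sequence μ_0 = ρ, μ_{k+1}(s') = ∑_s μ_k(s) P^π(s'|s)
    (μ : ℕ → S → ℝ) (hμ0 : ∀ s, μ 0 s = ∑ a : A, ρ (s, a))
    (hμsucc : ∀ k s', μ (k + 1) s' = ∑ s : S, μ k s * (∑ a : A, P s a s' * π s a)) :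
    ∀ s : S, Summable (fun k : ℕ => γ ^ k * μ k s) ∧
      lamS lam s = ∑' k : ℕ, γ ^ k * μ k s := by
  have hK0 : ∀ s s', 0 ≤ ∑ a : A, P s a s' * π s a := by
    intro s s'
    refine Finset.sum_nonneg fun a _ => mul_nonneg (hP0 _ _ _) ?_
    rw [hπ]
    exact div_nonneg (Finset.sum_nonneg fun _ _ => hlam0 _) (hlampos s).le
  have hK1 : ∀ s, ∑ s' : S, ∑ a : A, P s a s' * π s a = 1 := by
    intro s
    rw [Finset.sum_comm]
    simp_rw [← Finset.sum_mul, hP1, one_mul, hπ, ← Finset.sum_div]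
    exact div_self (hlampos s).ne'
  have hlamK : ∀ s s', lamS lam s * (∑ a : A, P s a s' * π s a)
      = ∑ a : A, P s a s' * lamSA lam s a := by
    intro s s'
    rw [Finset.mul_sum]
    refine Finset.sum_congr rfl fun a _ => ?_
    rw [hπ]
    have := (hlampos s).ne'
    field_simp
  have hfix : ∀ s', lamS lam s' = μ 0 s' +
      γ * ∑ s : S, lamS lam s * (∑ a : A, P s a s' * π s a) := by
    intro s'
    simp_rw [hlamK, hμ0, ← hlamc, Finset.sum_sub_distrib, ← Finset.mul_sum]
    have h : ∑ a : A, ∑ q : S × A, P q.1 q.2 s' * lam (q.1, q.2, a)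
        = ∑ s : S, ∑ a : A, P s a s' * lamSA lam s a := by
      rw [Finset.sum_comm, Fintype.sum_prod_type]
      simp_rw [lamSA, Finset.mul_sum]
    rw [h]
    simp only [lamS, lamSA]
    ring
  generalize hK : (fun s s' => ∑ a : A, P s a s' * π s a) = K at *
  have hKe : ∀ s s', ∑ a : A, P s a s' * π s a = K s s' := by
    intro s s'
    rw [← hK]
  simp only [hKe] at hK0 hK1 hfix hμsucc
  let r : ℕ → S → ℝ := fun n => Nat.rec (lamS lam) (fun _ f s' => ∑ s, f s * K s s') n
  have r0 : r 0 = lamS lam := rfl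
  have rs : ∀ n s', r (n + 1) s' = ∑ s, r n s * K s s' := fun _ _ => rfl
  clear_value r
  have hr0 : ∀ n s, 0 ≤ r n s := by
    intro n
    induction n with
    | zero => intro s; rw [r0]; exact (hlampos s).le
    | succ n ih =>
      intro s
      rw [rs]
      exact Finset.sum_nonneg fun i _ => mul_nonneg (ih i) (hK0 _ _)
  have hr1 : ∀ n, ∑ s, r n s = ∑ s, lamS lam s := by
    intro n
    induction n with
    | zero => rw [r0]
    | succ n ih =>
      simp_rw [rs]
      rw [Finset.sum_comm]
      simp_rw [← Finset.mul_sum, hK1, mul_one]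
      exact ih
  have hμn : ∀ n s, 0 ≤ μ n s := by
    intro n
    induction n with
    | zero => intro s; rw [hμ0]; exact Finset.sum_nonneg fun _ _ => (hρ0 _).le
    | succ n ih =>
      intro s
      rw [hμsucc]
      exact Finset.sum_nonneg fun i _ => mul_nonneg (ih i) (hK0 _ _)
  have hrec : ∀ n s, r n s = μ n s + γ * r (n + 1) s := by
    intro n
    induction n with
    | zero => intro s; rw [rs, r0]; exact hfix s
    | succ n ih =>
      intro s
      rw [rs (n + 1), hμsucc, rs n, Finset.mul_sum, ← Finset.sum_add_distrib]
      refine Finset.sum_congr rfl fun i _ => ?_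
      rw [ih i]
      ring
  have hpart : ∀ n s, ∑ k ∈ Finset.range n, γ ^ k * μ k s = lamS lam s - γ ^ n * r n s := by
    intro n s
    induction n with
    | zero => simp [r0]
    | succ n ih =>
      rw [Finset.sum_range_succ, ih, hrec n s]
      ring
  intro s
  have hlim : Filter.Tendsto (fun n => γ ^ n * r n s) Filter.atTop (nhds 0) := by
    have h1 : Filter.Tendsto (fun n => γ ^ n * ∑ s, lamS lam s) Filter.atTop (nhds 0) := by
      simpa using (tendsto_pow_atTop_nhds_zero_of_lt_one hγ0 hγ1).mul_const (∑ s, lamS lam s)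
    refine squeeze_zero (fun n => mul_nonneg (pow_nonneg hγ0 n) (hr0 n s)) (fun n => ?_) h1
    refine mul_le_mul_of_nonneg_left ?_ (pow_nonneg hγ0 n)
    rw [← hr1 n]
    exact Finset.single_le_sum (fun i _ => hr0 n i) (Finset.mem_univ s)
  have hs : HasSum (fun k : ℕ => γ ^ k * μ k s) (lamS lam s) := by
    rw [hasSum_iff_tendsto_nat_of_nonneg
      (fun k => mul_nonneg (pow_nonneg hγ0 k) (hμn k s))]
    simp_rw [hpart]
    simpa using hlim.const_sub (lamS lam s)
  exact ⟨hs.summable, hs.tsum_eq.symm⟩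
end

section
/- Let λ : S × A × A → ℝ be dual feasible with λ(s) > 0 for all s (which holds for every dual feasible λ), and let π(a|s) := λ(s,a)/λ(s) be the induced policy. Then the dual objective value equals the MDP objective of π: ∑_{(s,a,a')∈S×A×A} λ(s,a,a') R(s,a) = ∑_{s∈S} ρ(s) V^π(s) = J^π. -/
open Finset

variable {S A : Type*}

theorem stmt8 [Fintype S] [Fintype A] [Nonempty S] [Nonempty A]
    (P : S → A → S → ℝ)
    (hP0 : ∀ s a s', 0 ≤ P s a s') (hP1 : ∀ s a, ∑ s' : S, P s a s' = 1)
    (R : S → A → ℝ) (γ : ℝ) (hγ0 : 0 ≤ γ) (hγ1 : γ < 1)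
    (ρ : S × A → ℝ) (hρ0 : ∀ p, 0 < ρ p) (hρ1 : ∑ p : S × A, ρ p = 1)
    (lam : S × A × A → ℝ) (hlam0 : ∀ t, 0 ≤ lam t)
    -- dual feasibility constraints
    (hlamc : ∀ s a, (∑ i : A, lam (s, a, i)) -
      γ * ∑ q : S × A, P q.1 q.2 s * lam (q.1, q.2, a) = ρ (s, a))
    -- positivity of the state marginal (which holds for every dual feasible λ)
    (hlampos : ∀ s, 0 < lamS lam s)
    -- the induced policy π(a|s) = λ(s,a)/λ(s)
    (π : S → A → ℝ) (hπ : ∀ s a, π s a = lamSA lam s a / lamS lam s)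
    -- V^π : the value function of π
    (V : S → ℝ)
    (hV : ∀ s, V s = ∑ a : A, π s a * (R s a + γ * ∑ s' : S, P s a s' * V s')) :
    ∑ t : S × A × A, lam t * R t.1 t.2.1 = ∑ s : S, (∑ a : A, ρ (s, a)) * V s := by
  have h1 : ∀ s, ∑ a : A, ρ (s, a) =
      lamS lam s - γ * ∑ i : S, ∑ j : A, P i j s * lamSA lam i j := by
    intro s
    simp only [← hlamc, lamS, lamSA, Finset.sum_sub_distrib, ← Finset.mul_sum,
      Fintype.sum_prod_type]
    congr 2
    rw [Finset.sum_comm]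
    refine Finset.sum_congr rfl fun i _ => ?_
    rw [Finset.sum_comm]
    refine Finset.sum_congr rfl fun j _ => ?_
    rw [Finset.mul_sum]
  have h2 : ∀ s, lamS lam s * V s = ∑ a : A, lamSA lam s a * R s a +
      γ * ∑ a : A, lamSA lam s a * ∑ s' : S, P s a s' * V s' := by
    intro s
    rw [hV s, Finset.mul_sum, Finset.mul_sum, ← Finset.sum_add_distrib]
    refine Finset.sum_congr rfl fun a _ => ?_
    rw [hπ]
    have := (hlampos s).ne'
    field_simp
  have h3 : ∑ t : S × A × A, lam t * R t.1 t.2.1 = ∑ s : S, ∑ a : A, lamSA lam s a * R s a := by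
    simp only [Fintype.sum_prod_type, lamSA, Finset.sum_mul]
  have h4 : ∑ s : S, (∑ i : S, ∑ j : A, P i j s * lamSA lam i j) * V s =
      ∑ s : S, ∑ a : A, lamSA lam s a * ∑ s' : S, P s a s' * V s' := by
    simp only [Finset.sum_mul, Finset.mul_sum]
    rw [Finset.sum_comm]
    refine Finset.sum_congr rfl fun i _ => ?_
    rw [Finset.sum_comm]
    refine Finset.sum_congr rfl fun j _ => Finset.sum_congr rfl fun k _ => ?_
    ring
  simp only [h1, sub_mul, Finset.sum_sub_distrib, h2, Finset.sum_add_distrib, mul_assoc,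
    ← Finset.mul_sum, h4]
  rw [h3]
  ring
end

section
/- Let λ : S × A → ℝ satisfy λ(s,a) ≥ 0 for all (s,a) and the policy-evaluation dual feasibility constraints λ(s,a) − γ ∑_{(i,j)∈S×A} P(s|i,j) π(a|s) λ(i,j) = ρ(s,a) for all (s,a). Then (1 − γ)λ is a probability distribution on S × A: ∑_{(s,a)∈S×A} (1 − γ) λ(s,a) = 1. -/
open Finset

variable {S A : Type*}

theorem stmt11 [Fintype S] [Fintype A] [Nonempty S] [Nonempty A]
    (P : S → A → S → ℝ)
    (hP0 : ∀ s a s', 0 ≤ P s a s') (hP1 : ∀ s a, ∑ s' : S, P s a s' = 1)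
    (γ : ℝ) (hγ0 : 0 ≤ γ) (hγ1 : γ < 1)
    (ρ : S × A → ℝ) (hρ0 : ∀ p, 0 < ρ p) (hρ1 : ∑ p : S × A, ρ p = 1)
    (π : S → A → ℝ) (hπ0 : ∀ s a, 0 ≤ π s a) (hπ1 : ∀ s, ∑ a : A, π s a = 1)
    (lam : S × A → ℝ) (hlam0 : ∀ p, 0 ≤ lam p)
    -- policy-evaluation dual feasibility constraints
    (hlamc : ∀ s a, lam (s, a) -
      γ * ∑ q : S × A, P q.1 q.2 s * π s a * lam q = ρ (s, a)) :
    ∑ p : S × A, (1 - γ) * lam p = 1 := by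
  have key : ∑ p : S × A, ∑ q : S × A, P q.1 q.2 p.1 * π p.1 p.2 * lam q
      = ∑ q : S × A, lam q := by
    rw [Finset.sum_comm]
    refine Finset.sum_congr rfl fun q _ => ?_
    rw [← Finset.sum_mul, Fintype.sum_prod_type]
    simp only [← Finset.mul_sum, hπ1, mul_one, hP1, one_mul]
  have h : ∑ p : S × A, (lam p - γ * ∑ q : S × A, P q.1 q.2 p.1 * π p.1 p.2 * lam q)
      = ∑ p : S × A, ρ p :=
    Finset.sum_congr rfl fun p _ => hlamc p.1 p.2
  rw [Finset.sum_sub_distrib, ← Finset.mul_sum, key, hρ1] at h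
  rw [← Finset.mul_sum]
  linarith
end

section
/- The policy-evaluation LP has a unique optimal solution, which is the Q-function of π: if Q̂ : S × A → ℝ satisfies (T^π Q̂)(s,a) ≤ Q̂(s,a) for all (s,a) and ∑_{(s,a)} ρ(s,a) Q̂(s,a) ≤ ∑_{(s,a)} ρ(s,a) Q(s,a) for every Q with T^π Q ≤ Q pointwise, then Q̂ = Q^π. -/
open Finset

variable {S A : Type*}

/-- The policy Bellman operator
`(T^π Q)(s,a) = R(s,a) + γ ∑_{(s',a')} P(s'|s,a) π(a'|s') Q(s',a')`. -/
noncomputable def Tpi [Fintype S] [Fintype A] (P : S → A → S → ℝ) (R : S → A → ℝ) (γ : ℝ)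
    (π : S → A → ℝ) (Q : S × A → ℝ) (s : S) (a : A) : ℝ :=
  R s a + γ * ∑ q : S × A, P s a q.1 * π q.1 q.2 * Q q

theorem stmt13 [Fintype S] [Fintype A] [Nonempty S] [Nonempty A]
    (P : S → A → S → ℝ) (R : S → A → ℝ) (γ : ℝ)
    (hP0 : ∀ s a s', 0 ≤ P s a s') (hP1 : ∀ s a, ∑ s' : S, P s a s' = 1)
    (hγ0 : 0 ≤ γ) (hγ1 : γ < 1)
    (ρ : S × A → ℝ) (hρ0 : ∀ p, 0 < ρ p) (hρ1 : ∑ p : S × A, ρ p = 1)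
    (π : S → A → ℝ) (hπ0 : ∀ s a, 0 ≤ π s a) (hπ1 : ∀ s, ∑ a : A, π s a = 1)
    (Qpi : S × A → ℝ) (hQpi : ∀ s a, Tpi P R γ π Qpi s a = Qpi (s, a))
    (Qhat : S × A → ℝ)
    -- Q̂ is feasible for the policy-evaluation LP
    (hfeas : ∀ s a, Tpi P R γ π Qhat s a ≤ Qhat (s, a))
    -- Q̂ is optimal for the policy-evaluation LP
    (hopt : ∀ Q : S × A → ℝ, (∀ s a, Tpi P R γ π Q s a ≤ Q (s, a)) →
      ∑ p : S × A, ρ p * Qhat p ≤ ∑ p : S × A, ρ p * Q p) :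
    Qhat = Qpi := by
  have hsum : ∀ s a, ∑ q : S × A, P s a q.1 * π q.1 q.2 = 1 := by
    intro s a
    rw [Fintype.sum_prod_type]
    simp only [← Finset.mul_sum, hπ1, mul_one, hP1]
  have hge : ∀ p, Qpi p ≤ Qhat p := by
    obtain ⟨⟨s, a⟩, hmin⟩ := Finite.exists_min (fun p => Qhat p - Qpi p)
    have h1 := hfeas s a
    have h2 := hQpi s a
    unfold Tpi at h1 h2
    have h3 : (Qhat (s, a) - Qpi (s, a)) ≤
        ∑ q : S × A, P s a q.1 * π q.1 q.2 * Qhat q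
          - ∑ q : S × A, P s a q.1 * π q.1 q.2 * Qpi q := by
      rw [← Finset.sum_sub_distrib]
      calc Qhat (s, a) - Qpi (s, a)
          = ∑ q : S × A, P s a q.1 * π q.1 q.2 * (Qhat (s, a) - Qpi (s, a)) := by
            rw [← Finset.sum_mul, hsum, one_mul]
        _ ≤ _ := by
            apply Finset.sum_le_sum
            intro q _
            rw [← mul_sub]
            exact mul_le_mul_of_nonneg_left (hmin q) (mul_nonneg (hP0 _ _ _) (hπ0 _ _))
    have h4 := mul_le_mul_of_nonneg_left h3 hγ0
    have h5 : 0 ≤ Qhat (s, a) - Qpi (s, a) := by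
      by_contra hneg
      push Not at hneg
      nlinarith
    intro p
    have := hmin p
    linarith
  have hle := hopt Qpi (fun s a => (hQpi s a).le)
  have hterm : ∀ p ∈ (Finset.univ : Finset (S × A)), ρ p * Qpi p ≤ ρ p * Qhat p :=
    fun p _ => mul_le_mul_of_nonneg_left (hge p) (hρ0 p).le
  have heq := (Finset.sum_eq_sum_iff_of_le hterm).1 (le_antisymm (Finset.sum_le_sum hterm) hle)
  funext p
  exact (mul_left_cancel₀ (hρ0 p).ne' (heq p (Finset.mem_univ p))).symm
end

section
/- For every Q in the strictly feasible domain D, the log-barrier objective f_η is differentiable at Q and its gradient G(Q) is given componentwise by G(Q)(s,a) = ρ(s,a) + γ ∑_{(s',a')∈S×A} P(s|s',a') λ_η(s',a',a) − ∑_{a'∈A} λ_η(s,a,a'), where λ_η(s,a,a') := η w(s,a,a') / (Q(s,a) − (FQ)(s,a,a')). -/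
open Finset

variable {S A : Type*}

/-- `f_η` is differentiable at every `Q ∈ D`, with gradient `G(Q)` with respect to
the standard inner product: the Fréchet derivative is `h ↦ ∑_{(s,a)} G(Q)(s,a) h(s,a)`. -/
theorem stmt14 [Fintype S] [Fintype A] [Nonempty S] [Nonempty A]
    (P : S → A → S → ℝ) (R : S → A → ℝ) (γ : ℝ)
    (hP0 : ∀ s a s', 0 ≤ P s a s') (hP1 : ∀ s a, ∑ s' : S, P s a s' = 1)
    (hγ0 : 0 ≤ γ) (hγ1 : γ < 1)
    (ρ : S × A → ℝ) (hρ0 : ∀ p, 0 < ρ p) (hρ1 : ∑ p : S × A, ρ p = 1)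
    (w : S × A × A → ℝ) (hw : ∀ t, 0 < w t) (η : ℝ) (hη : 0 < η)
    (Q : S × A → ℝ) (hQ : Q ∈ FeasDom P R γ) :
    HasFDerivAt (fObj P R γ ρ w η)
      (∑ p : S × A, Gmap P R γ ρ w η Q p •
        (ContinuousLinearMap.proj p : ((S × A) → ℝ) →L[ℝ] ℝ)) Q := by
  have hL : ∀ t : S × A × A, HasFDerivAt
      (fun Q : S × A → ℝ => Q (t.1, t.2.1) - Fop P R γ Q t.1 t.2.1 t.2.2)
      ((ContinuousLinearMap.proj (t.1, t.2.1) : ((S × A) → ℝ) →L[ℝ] ℝ) -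
        γ • ∑ s' : S, P t.1 t.2.1 s' •
          (ContinuousLinearMap.proj (s', t.2.2) : ((S × A) → ℝ) →L[ℝ] ℝ)) Q := by
    intro t
    unfold Fop
    refine (hasFDerivAt_apply (t.1, t.2.1) Q).sub ?_
    refine HasFDerivAt.const_add _ (HasFDerivAt.const_mul ?_ γ)
    exact HasFDerivAt.fun_sum fun s' _ => (hasFDerivAt_apply (s', t.2.2) Q).const_mul _
  have hmain : HasFDerivAt (fObj P R γ ρ w η) _ Q :=
    (HasFDerivAt.fun_sum (u := Finset.univ) fun p _ =>
      (hasFDerivAt_apply p Q).const_mul (ρ p)).sub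
    ((HasFDerivAt.fun_sum (u := Finset.univ) fun t _ =>
      ((hL t).log (sub_pos.2 (hQ t.1 t.2.1 t.2.2)).ne').const_mul (w t)).const_mul η)
  refine hmain.congr_fderiv ?_
  refine ContinuousLinearMap.ext fun h => ?_
  have e1 : ∑ p : S × A, (∑ a' : A, lamEta P R γ w η Q p.1 p.2 a') * h p
      = ∑ t : S × A × A, lamEta P R γ w η Q t.1 t.2.1 t.2.2 * h (t.1, t.2.1) := by
    simp only [Fintype.sum_prod_type, Finset.sum_mul]
  have e2 : ∑ p : S × A, (γ * ∑ q : S × A, P q.1 q.2 p.1 * lamEta P R γ w η Q q.1 q.2 p.2) * h p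
      = ∑ t : S × A × A, lamEta P R γ w η Q t.1 t.2.1 t.2.2 *
          (γ * ∑ s' : S, P t.1 t.2.1 s' * h (s', t.2.2)) := by
    simp only [Finset.sum_mul, Finset.mul_sum]
    rw [Finset.sum_comm]
    simp only [Fintype.sum_prod_type]
    refine Finset.sum_congr rfl fun s _ => Finset.sum_congr rfl fun a _ => ?_
    rw [Finset.sum_comm]
    refine Finset.sum_congr rfl fun a' _ => Finset.sum_congr rfl fun s' _ => ?_
    ring
  have e3 : ∑ p : S × A, Gmap P R γ ρ w η Q p * h p = ∑ p : S × A, ρ p * h p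
      + ∑ p : S × A, (γ * ∑ q : S × A, P q.1 q.2 p.1 * lamEta P R γ w η Q q.1 q.2 p.2) * h p
      - ∑ p : S × A, (∑ a' : A, lamEta P R γ w η Q p.1 p.2 a') * h p := by
    simp only [Gmap, sub_mul, add_mul, Finset.sum_sub_distrib, Finset.sum_add_distrib]
  simp only [ContinuousLinearMap.sub_apply, ContinuousLinearMap.smul_apply,
    ContinuousLinearMap.sum_apply, ContinuousLinearMap.proj_apply, smul_eq_mul]
  rw [e3, e1, e2, add_sub_assoc, ← Finset.sum_sub_distrib, sub_eq_add_neg, Finset.mul_sum,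
    ← Finset.sum_neg_distrib]
  congr 1
  refine Finset.sum_congr rfl fun t _ => ?_
  simp only [lamEta]
  ring
end

section
/- The log-barrier objective f_η is strictly convex on its domain D: for all Q, Q' ∈ D with Q ≠ Q' and all t ∈ (0,1), f_η(t·Q + (1−t)·Q') < t·f_η(Q) + (1−t)·f_η(Q'). -/
open Finset

variable {S A : Type*}

/-- The slack `Q - FQ` determines `Q`, by the max-norm contraction. -/
lemma slack_inj [Fintype S] [Fintype A] [Nonempty S] [Nonempty A]
    (P : S → A → S → ℝ) (R : S → A → ℝ) (γ : ℝ)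
    (hP0 : ∀ s a s', 0 ≤ P s a s') (hP1 : ∀ s a, ∑ s' : S, P s a s' = 1)
    (hγ0 : 0 ≤ γ) (hγ1 : γ < 1) (Q Q' : S × A → ℝ)
    (h : ∀ s a a', Q (s, a) - Fop P R γ Q s a a' = Q' (s, a) - Fop P R γ Q' s a a') :
    Q = Q' := by
  obtain ⟨⟨s, a⟩, hm⟩ := Finite.exists_max (fun p : S × A => |Q p - Q' p|)
  have h1 : Q (s, a) - Q' (s, a) = γ * ∑ s' : S, P s a s' * (Q (s', a) - Q' (s', a)) := by
    have := h s a a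
    simp only [Fop] at this
    simp only [mul_sub, Finset.sum_sub_distrib]
    linarith
  have h2 : |∑ s' : S, P s a s' * (Q (s', a) - Q' (s', a))| ≤ |Q (s, a) - Q' (s, a)| := by
    calc _ ≤ ∑ s' : S, |P s a s' * (Q (s', a) - Q' (s', a))| := Finset.abs_sum_le_sum_abs _ _
      _ ≤ ∑ s' : S, P s a s' * |Q (s, a) - Q' (s, a)| := by
        apply Finset.sum_le_sum
        intro s' _
        rw [abs_mul, abs_of_nonneg (hP0 s a s')]
        exact mul_le_mul_of_nonneg_left (hm (s', a)) (hP0 s a s')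
      _ = _ := by rw [← Finset.sum_mul, hP1, one_mul]
  have h3 : |Q (s, a) - Q' (s, a)| ≤ γ * |Q (s, a) - Q' (s, a)| := by
    conv_lhs => rw [h1, abs_mul, abs_of_nonneg hγ0]
    exact mul_le_mul_of_nonneg_left h2 hγ0
  have h4 : |Q (s, a) - Q' (s, a)| ≤ 0 := by
    nlinarith [abs_nonneg (Q (s, a) - Q' (s, a))]
  funext p
  have h5 := (hm p).trans h4
  have := abs_nonpos_iff.mp h5
  linarith

theorem stmt15 [Fintype S] [Fintype A] [Nonempty S] [Nonempty A]
    (P : S → A → S → ℝ) (R : S → A → ℝ) (γ : ℝ)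
    (hP0 : ∀ s a s', 0 ≤ P s a s') (hP1 : ∀ s a, ∑ s' : S, P s a s' = 1)
    (hγ0 : 0 ≤ γ) (hγ1 : γ < 1)
    (ρ : S × A → ℝ) (hρ0 : ∀ p, 0 < ρ p) (hρ1 : ∑ p : S × A, ρ p = 1)
    (w : S × A × A → ℝ) (hw : ∀ t, 0 < w t) (η : ℝ) (hη : 0 < η) :
    ∀ Q ∈ FeasDom P R γ, ∀ Q' ∈ FeasDom P R γ, Q ≠ Q' →
      ∀ t : ℝ, 0 < t → t < 1 →
        fObj P R γ ρ w η (t • Q + (1 - t) • Q') <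
          t * fObj P R γ ρ w η Q + (1 - t) * fObj P R γ ρ w η Q' := by
  intro Q hQ Q' hQ' hne t ht0 ht1
  have ht1' : 0 < 1 - t := by linarith
  have hslack : ∀ s a a', (t • Q + (1 - t) • Q') (s, a)
        - Fop P R γ (t • Q + (1 - t) • Q') s a a' =
      t * (Q (s, a) - Fop P R γ Q s a a') + (1 - t) * (Q' (s, a) - Fop P R γ Q' s a a') := by
    intro s a a'
    have : ∑ s' : S, P s a s' * (t • Q + (1 - t) • Q') (s', a') =
        t * ∑ s' : S, P s a s' * Q (s', a') + (1 - t) * ∑ s' : S, P s a s' * Q' (s', a') := by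
      rw [Finset.mul_sum, Finset.mul_sum, ← Finset.sum_add_distrib]
      refine Finset.sum_congr rfl fun s' _ => ?_
      simp only [Pi.add_apply, Pi.smul_apply, smul_eq_mul]
      ring
    simp only [Fop, this]
    simp only [Pi.add_apply, Pi.smul_apply, smul_eq_mul]
    ring
  have hlin : ∑ p : S × A, ρ p * (t • Q + (1 - t) • Q') p =
      t * ∑ p : S × A, ρ p * Q p + (1 - t) * ∑ p : S × A, ρ p * Q' p := by
    rw [Finset.mul_sum, Finset.mul_sum, ← Finset.sum_add_distrib]
    refine Finset.sum_congr rfl fun s' _ => ?_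
    simp only [Pi.add_apply, Pi.smul_apply, smul_eq_mul]
    ring
  have hstrict : ∀ x y : ℝ, 0 < x → 0 < y → x ≠ y →
      t * Real.log x + (1 - t) * Real.log y < Real.log (t * x + (1 - t) * y) := by
    intro x y hx hy hxy
    have := strictConcaveOn_log_Ioi.2 (Set.mem_Ioi.mpr hx) (Set.mem_Ioi.mpr hy) hxy ht0 ht1'
      (by ring)
    simpa only [smul_eq_mul] using this
  obtain ⟨s, a, a', hsa⟩ : ∃ s a a',
      Q (s, a) - Fop P R γ Q s a a' ≠ Q' (s, a) - Fop P R γ Q' s a a' := by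
    by_contra hcon
    push Not at hcon
    exact hne (slack_inj P R γ hP0 hP1 hγ0 hγ1 Q Q' hcon)
  have hsum : t * ∑ u : S × A × A, w u * Real.log (Q (u.1, u.2.1) - Fop P R γ Q u.1 u.2.1 u.2.2)
      + (1 - t) * ∑ u : S × A × A,
        w u * Real.log (Q' (u.1, u.2.1) - Fop P R γ Q' u.1 u.2.1 u.2.2) <
      ∑ u : S × A × A, w u * Real.log ((t • Q + (1 - t) • Q') (u.1, u.2.1)
        - Fop P R γ (t • Q + (1 - t) • Q') u.1 u.2.1 u.2.2) := by
    rw [Finset.mul_sum, Finset.mul_sum, ← Finset.sum_add_distrib]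
    apply Finset.sum_lt_sum
    · rintro ⟨s, a, a'⟩ -
      simp only [hslack]
      by_cases he : Q (s, a) - Fop P R γ Q s a a' = Q' (s, a) - Fop P R γ Q' s a a'
      · have hx : ∀ x : ℝ, t * x + (1 - t) * x = x := fun x => by ring
        rw [he, hx, hx]
      · have := mul_lt_mul_of_pos_left (hstrict _ _ (sub_pos.mpr (hQ s a a'))
          (sub_pos.mpr (hQ' s a a')) he) (hw (s, a, a'))
        linarith
    · refine ⟨(s, a, a'), Finset.mem_univ _, ?_⟩
      simp only [hslack]
      have := mul_lt_mul_of_pos_left (hstrict _ _ (sub_pos.mpr (hQ s a a'))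
        (sub_pos.mpr (hQ' s a a')) hsa) (hw (s, a, a'))
      linarith
  have := mul_lt_mul_of_pos_left hsum hη
  simp only [fObj]
  rw [hlin]
  linarith
end

section
/- For every c ∈ ℝ, letting L_c := {Q ∈ D : f_η(Q) ≤ c} be the sublevel set, there exist constants μ > 0 and L > 0 such that f_η is μ-strongly convex on L_c and the gradient map G is L-Lipschitz on L_c with respect to the Euclidean norm: ‖G(Q) − G(Q')‖₂ ≤ L ‖Q − Q'‖₂ for all Q, Q' ∈ L_c. -/
open Finset

variable {S A : Type*}

/-- Slack of a constraint. -/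
noncomputable def slk [Fintype S] (P : S → A → S → ℝ) (R : S → A → ℝ) (γ : ℝ)
    (Q : S × A → ℝ) (t : S × A × A) : ℝ :=
  Q (t.1, t.2.1) - Fop P R γ Q t.1 t.2.1 t.2.2

lemma neglog_strong (M : ℝ) (hM : 0 < M) (x y : ℝ) (hx : 0 < x) (hxM : x ≤ M) (hy : 0 < y)
    (hyM : y ≤ M) (t : ℝ) (ht0 : 0 ≤ t) (ht1 : t ≤ 1) :
    t * Real.log x + (1 - t) * Real.log y + 1 / (2 * M ^ 2) * (t * (1 - t)) * (x - y) ^ 2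
      ≤ Real.log (t * x + (1 - t) * y) := by
  have hc : ConvexOn ℝ (Set.Ioc 0 M) (fun z => - Real.log z - 1 / (2 * M ^ 2) * z ^ 2) := by
    apply convexOn_of_hasDerivWithinAt2_nonneg (convex_Ioc 0 M)
      (f' := fun z => - z⁻¹ - 1 / (2 * M ^ 2) * (2 * z))
      (f'' := fun z => (z ^ 2)⁻¹ - 1 / (2 * M ^ 2) * 2)
    · apply ContinuousOn.sub
      · apply ContinuousOn.neg
        exact Real.continuousOn_log.mono (fun z hz => by simpa using hz.1.ne')
      · fun_prop
    · intro z hz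
      rw [interior_Ioc] at hz
      have h1 := (Real.hasDerivAt_log hz.1.ne').neg
      have h2 := ((hasDerivAt_pow 2 z).const_mul (1 / (2 * M ^ 2)))
      have h3 := (h1.sub h2).hasDerivWithinAt (s := interior (Set.Ioc 0 M))
      refine HasDerivWithinAt.congr_deriv (f := fun z => - Real.log z - 1 / (2 * M ^ 2) * z ^ 2) h3 ?_
      norm_num
    · intro z hz
      rw [interior_Ioc] at hz
      have h1 := (hasDerivAt_inv hz.1.ne').neg
      have h2 := ((hasDerivAt_id z).const_mul 2).const_mul (1 / (2 * M ^ 2))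
      have h3 := (h1.sub h2).hasDerivWithinAt (s := interior (Set.Ioc 0 M))
      refine HasDerivWithinAt.congr_deriv (f := fun z => - z⁻¹ - 1 / (2 * M ^ 2) * (2 * z)) h3 ?_
      norm_num
    · intro z hz
      rw [interior_Ioc] at hz
      have h1 : (M ^ 2)⁻¹ ≤ (z ^ 2)⁻¹ := by
        have := hz.1
        have := hz.2.le
        gcongr
      have h2 : 1 / (2 * M ^ 2) * 2 = (M ^ 2)⁻¹ := by field_simp
      rw [h2]; linarith
  have h := hc.2 ⟨hx, hxM⟩ ⟨hy, hyM⟩ ht0 (sub_nonneg.2 ht1) (by ring)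
  simp only [smul_eq_mul] at h
  nlinarith [h]

lemma exists_pos_le {ι : Type*} [Fintype ι] (f : ι → ℝ) (hf : ∀ i, 0 < f i) :
    ∃ m > 0, ∀ i, m ≤ f i := by
  cases isEmpty_or_nonempty ι
  · exact ⟨1, one_pos, fun i => isEmptyElim i⟩
  · obtain ⟨i, hi⟩ := Finite.exists_min f
    exact ⟨f i, hf i, hi⟩

lemma exists_le_bd {ι : Type*} [Fintype ι] (f : ι → ℝ) : ∃ B, 0 ≤ B ∧ ∀ i, -B ≤ f i := by
  refine ⟨∑ i, |f i|, Finset.sum_nonneg (fun i _ => abs_nonneg _), fun i => ?_⟩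
  have := Finset.single_le_sum (f := fun i => |f i|) (fun i _ => abs_nonneg _) (Finset.mem_univ i)
  linarith [neg_abs_le (f i)]

/-- Lower bound: `Q(s,a) - m0 ≥ slack`. -/
lemma slk_le [Fintype S] [Fintype A] [Nonempty S] [Nonempty A]
    (P : S → A → S → ℝ) (R : S → A → ℝ) (γ : ℝ)
    (hP0 : ∀ s a s', 0 ≤ P s a s') (hP1 : ∀ s a, ∑ s' : S, P s a s' = 1)
    (hγ0 : 0 ≤ γ) (hγ1 : γ < 1) :
    ∃ m0 : ℝ, ∀ Q ∈ FeasDom P R γ, ∀ t : S × A × A,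
      slk P R γ Q t ≤ Q (t.1, t.2.1) - m0 := by
  obtain ⟨B, hB0, hB⟩ := exists_le_bd (fun p : S × A => R p.1 p.2)
  have hg : 0 < 1 - γ := by linarith
  refine ⟨-B / (1 - γ), fun Q hQ t => ?_⟩
  obtain ⟨p, hp⟩ := Finite.exists_min Q
  have key : ∀ s a a' (m : ℝ), (∀ q, m ≤ Q q) → -B + γ * m ≤ Fop P R γ Q s a a' := by
    intro s a a' m hm
    have h1 : m ≤ ∑ s' : S, P s a s' * Q (s', a') := by
      calc m = ∑ s' : S, P s a s' * m := by rw [← Finset.sum_mul, hP1, one_mul]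
        _ ≤ _ := Finset.sum_le_sum (fun s' _ => mul_le_mul_of_nonneg_left (hm _) (hP0 _ _ _))
    have h2 := mul_le_mul_of_nonneg_left h1 hγ0
    have h3 := hB (s, a)
    simp only at h3
    unfold Fop
    linarith
  have hm0 : -B / (1 - γ) ≤ Q p := by
    rw [div_le_iff₀ hg]
    have h1 := key p.1 p.2 p.2 (Q p) hp
    have h2 := hQ p.1 p.2 p.2
    have h3 : Q (p.1, p.2) = Q p := rfl
    rw [h3] at h2
    nlinarith
  have h1 := key t.1 t.2.1 t.2.2 _ (fun q => hm0.trans (hp q))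
  have h2 : -B + γ * (-B / (1 - γ)) = -B / (1 - γ) := by field_simp; ring
  unfold slk
  linarith

lemma slk_bounds [Fintype S] [Fintype A] [Nonempty S] [Nonempty A]
    (P : S → A → S → ℝ) (R : S → A → ℝ) (γ : ℝ)
    (hP0 : ∀ s a s', 0 ≤ P s a s') (hP1 : ∀ s a, ∑ s' : S, P s a s' = 1)
    (hγ0 : 0 ≤ γ) (hγ1 : γ < 1)
    (ρ : S × A → ℝ) (hρ0 : ∀ p, 0 < ρ p) (hρ1 : ∑ p : S × A, ρ p = 1)
    (w : S × A × A → ℝ) (hw : ∀ t, 0 < w t) (η : ℝ) (hη : 0 < η) (c : ℝ) :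
    ∃ δ > 0, ∃ M > 0, ∀ Q ∈ SubLevel P R γ ρ w η c, ∀ t,
      δ ≤ slk P R γ Q t ∧ slk P R γ Q t ≤ M := by
  obtain ⟨m0, hm0⟩ := slk_le P R γ hP0 hP1 hγ0 hγ1
  obtain ⟨r, hr, hrρ⟩ := exists_pos_le ρ hρ0
  obtain ⟨w0, hw0, hw0w⟩ := exists_pos_le w hw
  set W := ∑ t, w t with hW
  have hWpos : 0 < W := Finset.sum_pos (fun t _ => hw t) Finset.univ_nonempty
  set e := r / (2 * (η * W)) with he
  have hepos : 0 < e := by positivity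
  set M := max 1 ((c - m0 + η * W * (-1 - Real.log e)) * (2 / r)) with hM
  have hM1 : 1 ≤ M := le_max_left _ _
  have hlM : 0 ≤ Real.log M := Real.log_nonneg hM1
  set K := max 0 (c - m0 + η * W * Real.log M) with hK
  refine ⟨Real.exp (-(K / (η * w0))), Real.exp_pos _, M, by linarith, ?_⟩
  rintro Q ⟨hQ, hf⟩
  have hx : ∀ t, 0 < slk P R γ Q t := fun t => sub_pos.2 (hQ _ _ _)
  have hz : ∀ p, 0 < Q p - m0 := fun p => by
    have h1 := hm0 Q hQ (p.1, p.2, p.2)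
    have h2 := hx (p.1, p.2, p.2)
    exact h2.trans_le h1
  set Z := ∑ p, (Q p - m0) with hZ
  have hZp : ∀ p, Q p - m0 ≤ Z := fun p =>
    Finset.single_le_sum (f := fun p => Q p - m0) (fun i _ => (hz i).le) (Finset.mem_univ p)
  have hxZ : ∀ t, slk P R γ Q t ≤ Z := fun t => (hm0 Q hQ t).trans (hZp _)
  have hZpos : 0 < Z := by
    obtain ⟨t⟩ : Nonempty (S × A × A) := inferInstance
    exact (hx t).trans_le (hxZ t)
  have hρQ : m0 + r * Z ≤ ∑ p, ρ p * Q p := by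
    have h1 : ∑ p, ρ p * Q p = m0 + ∑ p, ρ p * (Q p - m0) := by
      simp only [mul_sub, Finset.sum_sub_distrib, ← Finset.sum_mul, hρ1]; ring
    rw [h1, hZ, Finset.mul_sum]
    gcongr with p _
    · exact (hz p).le
    · exact hrρ p
  have hf' : ∑ p, ρ p * Q p - η * ∑ t, w t * Real.log (slk P R γ Q t) ≤ c := hf
  have hlog : ∀ T : ℝ, (∀ t, slk P R γ Q t ≤ T) →
      ∀ t, w t * Real.log (slk P R γ Q t) ≤ w t * Real.log T := fun T hT t =>
    mul_le_mul_of_nonneg_left (Real.log_le_log (hx t) (hT t)) (hw t).le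
  have hZM : Z ≤ M := by
    have h1 : ∑ t, w t * Real.log (slk P R γ Q t) ≤ W * Real.log Z := by
      rw [hW, Finset.sum_mul]
      exact Finset.sum_le_sum (fun t _ => hlog Z hxZ t)
    have h2 : Real.log Z ≤ e * Z - 1 - Real.log e := by
      have := Real.log_le_sub_one_of_pos (mul_pos hepos hZpos)
      rw [Real.log_mul hepos.ne' hZpos.ne'] at this
      linarith
    have h3 := mul_le_mul_of_nonneg_left h1 hη.le
    have h4 := mul_le_mul_of_nonneg_left h2 (mul_pos hη hWpos).le
    have h5 : η * W * (e * Z - 1 - Real.log e) = r / 2 * Z + η * W * (-1 - Real.log e) := by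
      have : η * W * e = r / 2 := by rw [he]; field_simp
      linear_combination Z * this
    have h6 : r / 2 * Z ≤ c - m0 + η * W * (-1 - Real.log e) := by nlinarith
    refine le_trans ?_ (le_max_right _ _)
    calc Z = (r / 2 * Z) * (2 / r) := by field_simp
      _ ≤ _ := by gcongr
  have hxM : ∀ t, slk P R γ Q t ≤ M := fun t => (hxZ t).trans hZM
  refine fun t => ⟨?_, hxM t⟩
  rw [← Real.le_log_iff_exp_le (hx t)]
  classical
  have h1 : ∑ u, w u * Real.log (slk P R γ Q u) ≤ w t * Real.log (slk P R γ Q t) + W * Real.log M := by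
    rw [← Finset.add_sum_erase _ _ (Finset.mem_univ t)]
    gcongr
    calc _ ≤ ∑ u ∈ Finset.univ.erase t, w u * Real.log M :=
          Finset.sum_le_sum (fun t _ => hlog M hxM t)
      _ ≤ ∑ u, w u * Real.log M := Finset.sum_le_sum_of_subset_of_nonneg (Finset.erase_subset _ _)
          (fun u _ _ => mul_nonneg (hw u).le hlM)
      _ = _ := by rw [Finset.sum_mul]
  have h2 := mul_le_mul_of_nonneg_left h1 hη.le
  have h3 : -K ≤ η * w t * Real.log (slk P R γ Q t) := by
    have : c - m0 + η * W * Real.log M ≤ K := le_max_right _ _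
    have : 0 < r * Z := by positivity
    nlinarith
  have hK0 : 0 ≤ K := le_max_left _ _
  by_contra hcon
  push Not at hcon
  have h4 : η * w t * Real.log (slk P R γ Q t) < η * w t * -(K / (η * w0)) :=
    mul_lt_mul_of_pos_left hcon (mul_pos hη (hw t))
  have h5 : K ≤ η * w t * (K / (η * w0)) := by
    calc K = η * w0 * (K / (η * w0)) := by field_simp
      _ ≤ _ := by gcongr; exact hw0w t
  linarith

lemma slk_diff [Fintype S] (P : S → A → S → ℝ) (R : S → A → ℝ) (γ : ℝ)
    (Q1 Q2 : S × A → ℝ) (t : S × A × A) :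
    slk P R γ Q1 t - slk P R γ Q2 t = (Q1 (t.1, t.2.1) - Q2 (t.1, t.2.1)) -
      γ * ∑ s', P t.1 t.2.1 s' * (Q1 (s', t.2.2) - Q2 (s', t.2.2)) := by
  simp only [slk, Fop, mul_sub, Finset.sum_sub_distrib]; ring

lemma slk_comb [Fintype S] (P : S → A → S → ℝ) (R : S → A → ℝ) (γ : ℝ)
    (Q1 Q2 : S × A → ℝ) (u : ℝ) (t : S × A × A) :
    slk P R γ (u • Q1 + (1 - u) • Q2) t = u * slk P R γ Q1 t + (1 - u) * slk P R γ Q2 t := by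
  have : ∑ s', P t.1 t.2.1 s' * (u * Q1 (s', t.2.2) + (1 - u) * Q2 (s', t.2.2)) =
      u * ∑ s', P t.1 t.2.1 s' * Q1 (s', t.2.2) +
        (1 - u) * ∑ s', P t.1 t.2.1 s' * Q2 (s', t.2.2) := by
    rw [Finset.mul_sum, Finset.mul_sum, ← Finset.sum_add_distrib]
    exact Finset.sum_congr rfl (fun _ _ => by ring)
  simp only [slk, Fop, Pi.add_apply, Pi.smul_apply, smul_eq_mul, this]; ring

lemma avg_abs_le [Fintype S] (P : S → A → S → ℝ)
    (hP0 : ∀ s a s', 0 ≤ P s a s') (hP1 : ∀ s a, ∑ s' : S, P s a s' = 1)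
    (γ : ℝ) (hγ0 : 0 ≤ γ) (s : S) (a : A) (v : S → ℝ) (N : ℝ) (hv : ∀ s, |v s| ≤ N) :
    |γ * ∑ s', P s a s' * v s'| ≤ γ * N := by
  rw [abs_mul, abs_of_nonneg hγ0]
  gcongr
  calc |∑ s', P s a s' * v s'| ≤ ∑ s', |P s a s' * v s'| := Finset.abs_sum_le_sum_abs _ _
    _ ≤ ∑ s', P s a s' * N := Finset.sum_le_sum (fun s' _ => by
        rw [abs_mul, abs_of_nonneg (hP0 _ _ _)]
        exact mul_le_mul_of_nonneg_left (hv _) (hP0 _ _ _))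
    _ = N := by rw [← Finset.sum_mul, hP1, one_mul]

lemma slk_inj [Fintype S] [Fintype A] [Nonempty S] [Nonempty A]
    (P : S → A → S → ℝ) (R : S → A → ℝ) (γ : ℝ)
    (hP0 : ∀ s a s', 0 ≤ P s a s') (hP1 : ∀ s a, ∑ s' : S, P s a s' = 1)
    (hγ0 : 0 ≤ γ) (hγ1 : γ < 1) (Q1 Q2 : S × A → ℝ) :
    (1 - γ) ^ 2 / (Fintype.card (S × A) : ℝ) * ∑ p, (Q1 p - Q2 p) ^ 2 ≤
      ∑ t, (slk P R γ Q1 t - slk P R γ Q2 t) ^ 2 := by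
  obtain ⟨p, hp⟩ := Finite.exists_max (fun p => |Q1 p - Q2 p|)
  have hn : (0 : ℝ) < Fintype.card (S × A) := by exact_mod_cast Fintype.card_pos
  have h1 : ∑ p, (Q1 p - Q2 p) ^ 2 ≤ Fintype.card (S × A) * |Q1 p - Q2 p| ^ 2 := by
    calc _ ≤ ∑ _q : S × A, |Q1 p - Q2 p| ^ 2 := Finset.sum_le_sum (fun q _ => by
          rw [← sq_abs (Q1 q - Q2 q)]; exact pow_le_pow_left₀ (abs_nonneg _) (hp q) 2)
      _ = _ := by simp
  have h2 : (1 - γ) * |Q1 p - Q2 p| ≤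
      |slk P R γ Q1 (p.1, p.2, p.2) - slk P R γ Q2 (p.1, p.2, p.2)| := by
    rw [slk_diff]
    have h3 := avg_abs_le P hP0 hP1 γ hγ0 p.1 p.2 (fun s' => Q1 (s', p.2) - Q2 (s', p.2)) _
      (fun s' => hp (s', p.2))
    have h4 := abs_sub_abs_le_abs_sub (Q1 p - Q2 p)
      (γ * ∑ s', P p.1 p.2 s' * (Q1 (s', p.2) - Q2 (s', p.2)))
    simp only [Prod.mk.eta]
    linarith
  calc _ ≤ (1 - γ) ^ 2 / (Fintype.card (S × A) : ℝ) * (Fintype.card (S × A) * |Q1 p - Q2 p| ^ 2) := by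
        gcongr
    _ = ((1 - γ) * |Q1 p - Q2 p|) ^ 2 := by field_simp
    _ ≤ |slk P R γ Q1 (p.1, p.2, p.2) - slk P R γ Q2 (p.1, p.2, p.2)| ^ 2 := by
        have : 0 ≤ 1 - γ := by linarith
        gcongr
    _ = (slk P R γ Q1 (p.1, p.2, p.2) - slk P R γ Q2 (p.1, p.2, p.2)) ^ 2 := sq_abs _
    _ ≤ _ := Finset.single_le_sum (f := fun t => (slk P R γ Q1 t - slk P R γ Q2 t) ^ 2)
        (fun t _ => sq_nonneg _) (Finset.mem_univ _)

theorem stmt16 [Fintype S] [Fintype A] [Nonempty S] [Nonempty A]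
    (P : S → A → S → ℝ) (R : S → A → ℝ) (γ : ℝ)
    (hP0 : ∀ s a s', 0 ≤ P s a s') (hP1 : ∀ s a, ∑ s' : S, P s a s' = 1)
    (hγ0 : 0 ≤ γ) (hγ1 : γ < 1)
    (ρ : S × A → ℝ) (hρ0 : ∀ p, 0 < ρ p) (hρ1 : ∑ p : S × A, ρ p = 1)
    (w : S × A × A → ℝ) (hw : ∀ t, 0 < w t) (η : ℝ) (hη : 0 < η) :
    ∀ c : ℝ, ∃ μ > 0, ∃ L > 0,
      -- μ-strong convexity of f_η on L_c (Euclidean norm)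
      (∀ Q1 ∈ SubLevel P R γ ρ w η c, ∀ Q2 ∈ SubLevel P R γ ρ w η c,
        ∀ t : ℝ, 0 ≤ t → t ≤ 1 →
          fObj P R γ ρ w η (t • Q1 + (1 - t) • Q2) ≤
            t * fObj P R γ ρ w η Q1 + (1 - t) * fObj P R γ ρ w η Q2 -
              μ / 2 * (t * (1 - t)) * ∑ p : S × A, (Q1 p - Q2 p) ^ 2) ∧
      -- L-Lipschitz continuity of the gradient map on L_c (Euclidean norm)
      (∀ Q1 ∈ SubLevel P R γ ρ w η c, ∀ Q2 ∈ SubLevel P R γ ρ w η c,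
        Real.sqrt (∑ p : S × A, (Gmap P R γ ρ w η Q1 p - Gmap P R γ ρ w η Q2 p) ^ 2) ≤
          L * Real.sqrt (∑ p : S × A, (Q1 p - Q2 p) ^ 2)) := by
  intro c
  obtain ⟨δ, hδ, M, hM, hb⟩ := slk_bounds P R γ hP0 hP1 hγ0 hγ1 ρ hρ0 hρ1 w hw η hη c
  obtain ⟨w0, hw0, hw0w⟩ := exists_pos_le w hw
  have hg : 0 < 1 - γ := by linarith
  have hn : (1 : ℝ) ≤ Fintype.card (S × A) := by exact_mod_cast Fintype.card_pos
  have hnA : (1 : ℝ) ≤ Fintype.card A := by exact_mod_cast Fintype.card_pos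
  set n : ℝ := (Fintype.card (S × A) : ℝ) with hndef
  set nA : ℝ := (Fintype.card A : ℝ) with hnAdef
  set W := ∑ t, w t with hW
  have hWpos : 0 < W := Finset.sum_pos (fun t _ => hw t) Finset.univ_nonempty
  set K := η * W * 2 / δ ^ 2 with hK
  have hKpos : 0 < K := by positivity
  refine ⟨η * w0 / M ^ 2 * ((1 - γ) ^ 2 / n), by positivity, n * ((n + nA) * K), by positivity, ?_, ?_⟩
  · intro Q1 h1 Q2 h2 t ht0 ht1
    have ht : 0 ≤ t * (1 - t) := mul_nonneg ht0 (sub_nonneg.2 ht1)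
    have hf : ∀ Q, fObj P R γ ρ w η Q =
      ∑ p, ρ p * Q p - η * ∑ t, w t * Real.log (slk P R γ Q t) := fun Q => rfl
    simp only [hf]
    have hlin : ∑ p, ρ p * (t • Q1 + (1 - t) • Q2) p =
        t * ∑ p, ρ p * Q1 p + (1 - t) * ∑ p, ρ p * Q2 p := by
      rw [Finset.mul_sum, Finset.mul_sum, ← Finset.sum_add_distrib]
      refine Finset.sum_congr rfl (fun _ _ => ?_)
      simp only [Pi.add_apply, Pi.smul_apply, smul_eq_mul]; ring
    have hs : t * ∑ u, w u * Real.log (slk P R γ Q1 u) +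
        (1 - t) * ∑ u, w u * Real.log (slk P R γ Q2 u) +
        w0 * (1 / (2 * M ^ 2) * (t * (1 - t))) * ∑ u, (slk P R γ Q1 u - slk P R γ Q2 u) ^ 2 ≤
        ∑ u, w u * Real.log (slk P R γ (t • Q1 + (1 - t) • Q2) u) := by
      rw [Finset.mul_sum, Finset.mul_sum, Finset.mul_sum, ← Finset.sum_add_distrib,
        ← Finset.sum_add_distrib]
      refine Finset.sum_le_sum (fun u _ => ?_)
      rw [slk_comb]
      have a1 := hb Q1 h1 u
      have a2 := hb Q2 h2 u
      have h := mul_le_mul_of_nonneg_left (neglog_strong M hM _ _ (hδ.trans_le a1.1) a1.2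
        (hδ.trans_le a2.1) a2.2 t ht0 ht1) (hw u).le
      have h' : 0 ≤ (1 / (2 * M ^ 2) * (t * (1 - t))) * (slk P R γ Q1 u - slk P R γ Q2 u) ^ 2 := by
        positivity
      have h'' := mul_le_mul_of_nonneg_right (hw0w u) h'
      linarith
    have hi := slk_inj P R γ hP0 hP1 hγ0 hγ1 Q1 Q2
    have hi' := mul_le_mul_of_nonneg_left hi
      (show 0 ≤ η * (w0 * (1 / (2 * M ^ 2) * (t * (1 - t)))) by positivity)
    have hs' := mul_le_mul_of_nonneg_left hs hη.le
    rw [hlin]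
    have he : η * w0 / M ^ 2 * ((1 - γ) ^ 2 / n) / 2 * (t * (1 - t)) * ∑ p, (Q1 p - Q2 p) ^ 2 =
      η * (w0 * (1 / (2 * M ^ 2) * (t * (1 - t)))) *
        ((1 - γ) ^ 2 / n * ∑ p, (Q1 p - Q2 p) ^ 2) := by
      field_simp
    rw [he]
    linarith
  · intro Q1 h1 Q2 h2
    set N := Real.sqrt (∑ p : S × A, (Q1 p - Q2 p) ^ 2) with hN
    have hN0 : 0 ≤ N := Real.sqrt_nonneg _
    have hΔ : ∀ p, |Q1 p - Q2 p| ≤ N := fun p => by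
      apply Real.abs_le_sqrt
      exact Finset.single_le_sum (f := fun p => (Q1 p - Q2 p) ^ 2) (fun t _ => sq_nonneg _)
        (Finset.mem_univ p)
    have hsd : ∀ t, |slk P R γ Q1 t - slk P R γ Q2 t| ≤ 2 * N := fun t => by
      rw [slk_diff]
      have h3 := avg_abs_le P hP0 hP1 γ hγ0 t.1 t.2.1
        (fun s' => Q1 (s', t.2.2) - Q2 (s', t.2.2)) N (fun s' => hΔ _)
      have h4 := abs_sub (Q1 (t.1, t.2.1) - Q2 (t.1, t.2.1))
        (γ * ∑ s', P t.1 t.2.1 s' * (Q1 (s', t.2.2) - Q2 (s', t.2.2)))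
      have h5 := hΔ (t.1, t.2.1)
      nlinarith
    have hlam : ∀ s a a', |lamEta P R γ w η Q1 s a a' - lamEta P R γ w η Q2 s a a'| ≤ K * N := by
      intro s a a'
      have a1 := (hb Q1 h1 (s, a, a')).1
      have a2 := (hb Q2 h2 (s, a, a')).1
      have a3 := hsd (s, a, a')
      have hl : ∀ Q, lamEta P R γ w η Q s a a' = η * w (s, a, a') / slk P R γ Q (s, a, a') :=
        fun Q => rfl
      rw [hl, hl]
      have hwW : w (s, a, a') ≤ W :=
        Finset.single_le_sum (f := w) (fun t _ => (hw t).le) (Finset.mem_univ _)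
      have hw' := hw (s, a, a')
      generalize slk P R γ Q1 (s, a, a') = x at *
      generalize slk P R γ Q2 (s, a, a') = y at *
      have hx := hδ.trans_le a1
      have hy := hδ.trans_le a2
      have : η * w (s, a, a') / x - η * w (s, a, a') / y =
        -(η * w (s, a, a') * (x - y) / (x * y)) := by field_simp; ring
      rw [this, abs_neg, abs_div, abs_mul, abs_of_pos (mul_pos hη hw'), abs_of_pos (mul_pos hx hy)]
      calc η * w (s, a, a') * |x - y| / (x * y) ≤ η * W * (2 * N) / (δ * δ) := by gcongr
        _ = K * N := by rw [hK]; field_simp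
    have hKN : 0 ≤ K * N := by positivity
    have hP1' : ∀ s a s', P s a s' ≤ 1 := fun s a s' => by
      rw [← hP1 s a]
      exact Finset.single_le_sum (f := P s a) (fun t _ => hP0 _ _ _) (Finset.mem_univ _)
    have hG : ∀ p, |Gmap P R γ ρ w η Q1 p - Gmap P R γ ρ w η Q2 p| ≤ (n + nA) * K * N := by
      intro p
      have e : Gmap P R γ ρ w η Q1 p - Gmap P R γ ρ w η Q2 p =
          γ * ∑ q : S × A, P q.1 q.2 p.1 *
            (lamEta P R γ w η Q1 q.1 q.2 p.2 - lamEta P R γ w η Q2 q.1 q.2 p.2) -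
          ∑ a' : A, (lamEta P R γ w η Q1 p.1 p.2 a' - lamEta P R γ w η Q2 p.1 p.2 a') := by
        simp only [Gmap, mul_sub, Finset.sum_sub_distrib]; ring
      have b1 : |∑ q : S × A, P q.1 q.2 p.1 *
            (lamEta P R γ w η Q1 q.1 q.2 p.2 - lamEta P R γ w η Q2 q.1 q.2 p.2)| ≤ n * (K * N) := by
        refine (Finset.abs_sum_le_sum_abs _ _).trans ?_
        calc _ ≤ ∑ _q : S × A, K * N := Finset.sum_le_sum (fun q _ => by
              rw [abs_mul, abs_of_nonneg (hP0 _ _ _)]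
              have := mul_le_mul (hP1' q.1 q.2 p.1) (hlam q.1 q.2 p.2) (abs_nonneg _) zero_le_one
              linarith)
          _ = _ := by simp [hndef]
      have b2 : |∑ a' : A, (lamEta P R γ w η Q1 p.1 p.2 a' - lamEta P R γ w η Q2 p.1 p.2 a')| ≤
          nA * (K * N) := by
        refine (Finset.abs_sum_le_sum_abs _ _).trans ?_
        calc _ ≤ ∑ _q : A, K * N := Finset.sum_le_sum (fun q _ => hlam _ _ _)
          _ = _ := by simp [hnAdef]
      rw [e]
      refine (abs_sub _ _).trans ?_
      rw [abs_mul, abs_of_nonneg hγ0]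
      have := mul_le_mul hγ1.le b1 (abs_nonneg _) zero_le_one
      linarith
    apply Real.sqrt_le_iff.2
    refine ⟨by positivity, ?_⟩
    calc _ ≤ ∑ _q : S × A, ((n + nA) * K * N) ^ 2 := Finset.sum_le_sum (fun q _ => by
          rw [← sq_abs]; exact pow_le_pow_left₀ (abs_nonneg _) (hG q) 2)
      _ = n * ((n + nA) * K * N) ^ 2 := by simp [hndef]
      _ ≤ n ^ 2 * ((n + nA) * K * N) ^ 2 := by
          gcongr
          nlinarith
      _ = _ := by ring
end

section
/- For every c ∈ ℝ there exists a constant m_c > 0 such that every Q in the sublevel set L_c := {Q ∈ D : f_η(Q) ≤ c} satisfies Q(s,a) − (FQ)(s,a,a') ≥ m_c for all (s,a,a') ∈ S × A × A; that is, on every sublevel set the slack of the LP inequality constraints is uniformly bounded away from zero. -/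
open Finset

variable {S A : Type*}

theorem stmt17 [Fintype S] [Fintype A] [Nonempty S] [Nonempty A]
    (P : S → A → S → ℝ) (R : S → A → ℝ) (γ : ℝ)
    (hP0 : ∀ s a s', 0 ≤ P s a s') (hP1 : ∀ s a, ∑ s' : S, P s a s' = 1)
    (hγ0 : 0 ≤ γ) (hγ1 : γ < 1)
    (ρ : S × A → ℝ) (hρ0 : ∀ p, 0 < ρ p) (hρ1 : ∑ p : S × A, ρ p = 1)
    (w : S × A × A → ℝ) (hw : ∀ t, 0 < w t) (η : ℝ) (hη : 0 < η) :
    ∀ c : ℝ, ∃ m > 0, ∀ Q ∈ SubLevel P R γ ρ w η c,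
      ∀ s a a', m ≤ Q (s, a) - Fop P R γ Q s a a' := by
  classical
  intro c
  obtain ⟨r, hr0, hr⟩ : ∃ r : ℝ, 0 ≤ r ∧ ∀ s a, -r ≤ R s a := by
    refine ⟨∑ p : S × A, |R p.1 p.2|, Finset.sum_nonneg fun _ _ => abs_nonneg _, fun s a => ?_⟩
    have h := Finset.single_le_sum (f := fun p : S × A => |R p.1 p.2|)
      (fun _ _ => abs_nonneg _) (Finset.mem_univ (s, a))
    have h2 := neg_abs_le (R s a)
    simp only at h
    linarith
  obtain ⟨B, hB⟩ : ∃ B : ℝ, (1 - γ) * B = r :=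
    ⟨r / (1 - γ), mul_div_cancel₀ r (sub_pos.2 hγ1).ne'⟩
  have hN : (0 : ℝ) < Fintype.card A := by exact_mod_cast Fintype.card_pos
  set N : ℝ := (Fintype.card A : ℝ) with hNdef
  let ε : S × A × A → ℝ := fun t => ρ (t.1, t.2.1) / (η * N * w t)
  have hε : ∀ t, 0 < ε t := fun t =>
    div_pos (hρ0 _) (mul_pos (mul_pos hη hN) (hw t))
  let K : S × A × A → ℝ := fun t => |η * w t * (1 + Real.log (ε t))|
  let C : ℝ := |c + B + ∑ t, K t|
  refine ⟨Real.exp (-∑ t, C / (η * w t)), Real.exp_pos _, ?_⟩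
  rintro Q ⟨hD, hf⟩ s a a'
  have hlow : ∀ p, -B ≤ Q p := by
    obtain ⟨p0, hp0⟩ := Finite.exists_min Q
    have h1 := hD p0.1 p0.2 p0.2
    have h2 : Q p0 ≤ ∑ s', P p0.1 p0.2 s' * Q (s', p0.2) := by
      calc Q p0 = ∑ s', P p0.1 p0.2 s' * Q p0 := by rw [← Finset.sum_mul, hP1, one_mul]
        _ ≤ _ := Finset.sum_le_sum fun s' _ => mul_le_mul_of_nonneg_left (hp0 _) (hP0 _ _ _)
    have h3 := mul_le_mul_of_nonneg_left h2 hγ0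
    have h4 := hr p0.1 p0.2
    simp only [Fop, Prod.mk.eta] at h1
    have h5 : -B ≤ Q p0 := by
      by_contra hcon
      push Not at hcon
      nlinarith
    exact fun p => h5.trans (hp0 p)
  let x : S × A × A → ℝ := fun t => Q (t.1, t.2.1) - Fop P R γ Q t.1 t.2.1 t.2.2
  have hx : ∀ t, 0 < x t := fun t => sub_pos.2 (hD _ _ _)
  have hxU : ∀ t, x t ≤ Q (t.1, t.2.1) + B := by
    intro t
    have h2 : -B ≤ ∑ s', P t.1 t.2.1 s' * Q (s', t.2.2) := by
      calc -B = ∑ s', P t.1 t.2.1 s' * (-B) := by rw [← Finset.sum_mul, hP1, one_mul]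
        _ ≤ _ := Finset.sum_le_sum fun s' _ => mul_le_mul_of_nonneg_left (hlow _) (hP0 _ _ _)
    have h3 := mul_le_mul_of_nonneg_left h2 hγ0
    have h4 := hr t.1 t.2.1
    simp only [x, Fop]
    linarith
  let g : S × A × A → ℝ := fun t =>
    ρ (t.1, t.2.1) * (Q (t.1, t.2.1) + B) / N + K t - η * (w t * Real.log (x t))
  have hg : ∀ t, 0 ≤ g t := by
    intro t
    have h1 := Real.log_le_sub_one_of_pos (mul_pos (hε t) (hx t))
    rw [Real.log_mul (hε t).ne' (hx t).ne'] at h1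
    have h2 := mul_le_mul_of_nonneg_left (hxU t) (hε t).le
    have h3 : Real.log (x t) ≤ ε t * (Q (t.1, t.2.1) + B) - (1 + Real.log (ε t)) := by linarith
    have hηw := mul_pos hη (hw t)
    have h4 := mul_le_mul_of_nonneg_left h3 hηw.le
    have h5 : η * w t * (ε t * (Q (t.1, t.2.1) + B)) = ρ (t.1, t.2.1) * (Q (t.1, t.2.1) + B) / N := by
      have := (hw t).ne'
      simp only [ε]
      field_simp
    have h6 : -K t ≤ η * w t * (1 + Real.log (ε t)) := neg_abs_le _
    simp only [g]
    rw [mul_sub, h5] at h4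
    linarith
  have hsumg : ∑ t, g t = fObj P R γ ρ w η Q + B + ∑ t, K t := by
    have h1 : ∑ t : S × A × A, ρ (t.1, t.2.1) * (Q (t.1, t.2.1) + B) / N
        = ∑ p : S × A, ρ p * Q p + B := by
      rw [Fintype.sum_prod_type]
      simp_rw [Fintype.sum_prod_type, Finset.sum_const, Finset.card_univ, nsmul_eq_mul]
      rw [← hNdef]
      simp_rw [mul_div_cancel₀ _ hN.ne', mul_add, Finset.sum_add_distrib]
      congr 1
      rw [Fintype.sum_prod_type] at hρ1
      simp_rw [← Finset.sum_mul]
      rw [hρ1, one_mul]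
    simp only [g, Finset.sum_sub_distrib, Finset.sum_add_distrib, h1, fObj, ← Finset.mul_sum, x]
    ring
  let t0 : S × A × A := (s, a, a')
  have hg0 : g t0 ≤ C := by
    have h1 := Finset.single_le_sum (f := g) (fun t _ => hg t) (Finset.mem_univ t0)
    have h2 : c + B + ∑ t, K t ≤ C := le_abs_self _
    linarith
  have hηw := mul_pos hη (hw t0)
  have hlog : -(C / (η * w t0)) ≤ Real.log (x t0) := by
    have h1 : 0 ≤ ρ (t0.1, t0.2.1) * (Q (t0.1, t0.2.1) + B) / N :=
      div_nonneg (mul_nonneg (hρ0 _).le (by linarith [hlow (t0.1, t0.2.1)])) hN.le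
    have h2 : 0 ≤ K t0 := abs_nonneg _
    simp only [g] at hg0
    rw [neg_le, le_div_iff₀ hηw]
    linarith
  have hs : C / (η * w t0) ≤ ∑ t, C / (η * w t) :=
    Finset.single_le_sum (f := fun t => C / (η * w t))
      (fun t _ => div_nonneg (abs_nonneg _) (mul_pos hη (hw t)).le) (Finset.mem_univ t0)
  change _ ≤ x t0
  rw [← Real.le_log_iff_exp_le (hx t0)]
  linarith
end

section
/- Suppose Q : S × A → ℝ satisfies r(s,a,s') + γ Q(s',a') − Q(s,a) < 0 for every (s,a,a',s') with P(s'|s,a) > 0. Then Q belongs to the strictly feasible domain D, and the log-barrier objective is bounded above by the sample-wise surrogate: f_η(Q) ≤ ∑_{(s,a)} ρ(s,a) Q(s,a) − η ∑_{(s,a,a')∈S×A×A} ∑_{s'∈S} P(s'|s,a) w(s,a,a') ln(Q(s,a) − r(s,a,s') − γ Q(s',a')). -/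
open Finset

variable {S A : Type*}

theorem jensen_log_aux {ι : Type*} [Fintype ι] (p x : ι → ℝ) (hp : ∀ i, 0 ≤ p i)
    (h1 : ∑ i, p i = 1) (hx : ∀ i, 0 < p i → 0 < x i) :
    0 < ∑ i, p i * x i ∧ ∑ i, p i * Real.log (x i) ≤ Real.log (∑ i, p i * x i) := by
  have hnn : ∀ i, 0 ≤ p i * x i := by
    intro i
    rcases (hp i).eq_or_lt with h | h
    · simp [← h]
    · exact (mul_pos h (hx i h)).le
  have hpos : 0 < ∑ i, p i * x i := by
    obtain ⟨i, hi⟩ : ∃ i, 0 < p i := by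
      by_contra hcon
      push Not at hcon
      have : ∑ i, p i ≤ 0 := Finset.sum_nonpos (fun i _ => hcon i)
      linarith
    exact Finset.sum_pos' (fun i _ => hnn i) ⟨i, Finset.mem_univ i, mul_pos hi (hx i hi)⟩
  refine ⟨hpos, ?_⟩
  generalize hm : ∑ i, p i * x i = m at hpos
  have key : ∀ i, p i * Real.log (x i) ≤ (p i * x i) / m - p i + p i * Real.log m := by
    intro i
    rcases (hp i).eq_or_lt with h | h
    · simp [← h]
    · have h2 := Real.log_le_sub_one_of_pos (div_pos (hx i h) hpos)
      rw [Real.log_div (hx i h).ne' hpos.ne'] at h2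
      have h3 := mul_le_mul_of_nonneg_left h2 h.le
      have h4 : p i * (x i / m - 1) = (p i * x i) / m - p i := by ring
      linarith
  calc ∑ i, p i * Real.log (x i)
      ≤ ∑ i, ((p i * x i) / m - p i + p i * Real.log m) := Finset.sum_le_sum (fun i _ => key i)
    _ = Real.log m := by
      rw [Finset.sum_add_distrib, Finset.sum_sub_distrib, ← Finset.sum_div, ← Finset.sum_mul,
        h1, hm, div_self hpos.ne']
      ring

theorem stmt19 [Fintype S] [Fintype A] [Nonempty S] [Nonempty A]
    (P : S → A → S → ℝ)
    (hP0 : ∀ s a s', 0 ≤ P s a s') (hP1 : ∀ s a, ∑ s' : S, P s a s' = 1)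
    (γ : ℝ) (hγ0 : 0 ≤ γ) (hγ1 : γ < 1)
    (r : S → A → S → ℝ) (R : S → A → ℝ)
    (hR : ∀ s a, R s a = ∑ s' : S, P s a s' * r s a s')
    (ρ : S × A → ℝ) (hρ0 : ∀ p, 0 < ρ p) (hρ1 : ∑ p : S × A, ρ p = 1)
    (w : S × A × A → ℝ) (hw : ∀ t, 0 < w t) (η : ℝ) (hη : 0 < η)
    (Q : S × A → ℝ)
    -- the sample-wise strict feasibility assumption
    (hQ : ∀ s a a' s', 0 < P s a s' → r s a s' + γ * Q (s', a') - Q (s, a) < 0) :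
    Q ∈ FeasDom P R γ ∧
    fObj P R γ ρ w η Q ≤
      ∑ p : S × A, ρ p * Q p -
        η * ∑ t : S × A × A, ∑ s' : S, P t.1 t.2.1 s' * w t *
          Real.log (Q (t.1, t.2.1) - r t.1 t.2.1 s' - γ * Q (s', t.2.2)) := by
  have hsum : ∀ s a a', ∑ s' : S, P s a s' * (Q (s, a) - r s a s' - γ * Q (s', a')) =
      Q (s, a) - Fop P R γ Q s a a' := by
    intro s a a'
    have : ∀ s', P s a s' * (Q (s, a) - r s a s' - γ * Q (s', a')) =
        P s a s' * Q (s, a) - P s a s' * r s a s' - γ * (P s a s' * Q (s', a')) := by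
      intro s'; ring
    simp only [this]
    rw [Finset.sum_sub_distrib, Finset.sum_sub_distrib, ← Finset.sum_mul, ← Finset.mul_sum,
      hP1, Fop, hR]
    ring
  have hJ := fun s a a' => jensen_log_aux (P s a)
    (fun s' => Q (s, a) - r s a s' - γ * Q (s', a')) (hP0 s a) (hP1 s a)
    (fun s' h => by have := hQ s a a' s' h; linarith)
  simp only [hsum] at hJ
  refine ⟨fun s a a' => by linarith [(hJ s a a').1], ?_⟩
  unfold fObj
  refine sub_le_sub_left (mul_le_mul_of_nonneg_left (Finset.sum_le_sum fun t _ => ?_) hη.le) _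
  have h := mul_le_mul_of_nonneg_left (hJ t.1 t.2.1 t.2.2).2 (hw t).le
  refine le_trans (le_of_eq ?_) h
  rw [Finset.mul_sum]
  exact Finset.sum_congr rfl fun s' _ => by ring
end
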